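/- arXiv:2407.20991 — 9 statements merged into one kernel-verified Lean document; each statement's English description precedes it below -/
import Mathlib

section
/- Let j ∈ ℂ with Re j > −1, let k ∈ ℕ, and let τ > 0. Then the limit lim_{ε→0⁺} ∫_0^∞ e^{iξτ − εξ} ξ^j (log ξ)^k dξ exists, and there exist constants c_{j,k,0}, …, c_{j,k,k} ∈ ℂ, independent of τ, such that this limit equals τ^{−j−1} · Σ_{κ=0}^{k} c_{j,k,κ} (log τ)^κ. Moreover the top coefficient satisfies c_{j,k,k} = e^{iπ(j+1)/2} (−1)^k Γ(j+1). -/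
open MeasureTheory Filter Set Topology

/-- The Mellin transform of `exp (-r t)` for complex `r` with positive real part. -/
theorem mellin_exp_neg_mul {s : ℂ} (hs : 0 < s.re) {r : ℂ} (hr : 0 < r.re) :
    mellin (fun t : ℝ => Complex.exp (-(r * t))) s =
      Complex.exp (-Complex.log r * s) * Complex.Gamma s := by
  have hopen : IsOpen {z : ℂ | 0 < z.re} := isOpen_lt continuous_const Complex.continuous_re
  have hcont (z : ℂ) :
      ContinuousOn (fun t : ℝ => (t : ℂ) ^ (s - 1) • Complex.exp (-(z * t))) (Ioi 0) :=
    ContinuousOn.smul (fun t ht =>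
      (Complex.continuousAt_ofReal_cpow_const _ _ (Or.inr (ne_of_gt ht))).continuousWithinAt)
      (by fun_prop)
  have hnorm (z w : ℂ) {t : ℝ} (ht : 0 < t) :
      ‖(t : ℂ) ^ w * Complex.exp (-(z * t))‖ = t ^ w.re * Real.exp (-z.re * t) := by
    rw [norm_mul, Complex.norm_cpow_eq_rpow_re_of_pos ht, Complex.norm_exp]
    simp
  have hbound {p b : ℝ} (hp : -1 < p) (hb : 0 < b) :
      IntegrableOn (fun t : ℝ => t ^ p * Real.exp (-b * t)) (Ioi 0) := by
    simpa using integrableOn_rpow_mul_exp_neg_mul_rpow hp one_pos hb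
  have hdiff : DifferentiableOn ℂ
      (fun z : ℂ => mellin (fun t : ℝ => Complex.exp (-(z * t))) s) {z | 0 < z.re} := by
    intro z (hz : 0 < z.re)
    refine DifferentiableAt.differentiableWithinAt ?_
    refine (hasDerivAt_integral_of_dominated_loc_of_deriv_le
      (μ := volume.restrict (Ioi 0))
      (F := fun z (t : ℝ) => (t : ℂ) ^ (s - 1) • Complex.exp (-(z * t)))
      (F' := fun z (t : ℝ) => (t : ℂ) ^ (s - 1) • (Complex.exp (-(z * t)) * -t))
      (bound := fun t => t ^ s.re * Real.exp (-(z.re / 2) * t))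
      (s := {w : ℂ | z.re / 2 < w.re}) ?_ ?_ ?_ ?_ ?_ (hbound (by linarith) (by positivity))
      ?_).2.differentiableAt
    · exact (isOpen_lt continuous_const Complex.continuous_re).mem_nhds (by simpa using hz)
    · exact .of_forall fun w => (hcont w).aestronglyMeasurable measurableSet_Ioi
    · refine (hbound (p := s.re - 1) (by linarith) hz).mono'
        ((hcont z).aestronglyMeasurable measurableSet_Ioi) ?_
      filter_upwards [ae_restrict_mem measurableSet_Ioi] with t ht
      rw [smul_eq_mul, hnorm z _ ht]
      simp
    · simp_rw [← smul_mul_assoc]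
      exact ((hcont z).mul (by fun_prop)).aestronglyMeasurable measurableSet_Ioi
    · filter_upwards [ae_restrict_mem measurableSet_Ioi] with t (ht : 0 < t) w (hw : _ < w.re)
      have h : t ^ s.re = t ^ (s - 1).re * t := by
        rw [← Real.rpow_add_one ht.ne']; simp
      rw [smul_eq_mul, ← mul_assoc, norm_mul, hnorm w _ ht, norm_neg, Complex.norm_real,
        Real.norm_of_nonneg ht.le, h, mul_right_comm]
      gcongr
    · refine .of_forall fun t w _ => HasDerivAt.fun_const_smul _ ?_
      simpa using ((hasDerivAt_id w).mul_const (t : ℂ)).neg.cexp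
  have hdiff' : DifferentiableOn ℂ
      (fun z : ℂ => Complex.exp (-Complex.log z * s) * Complex.Gamma s) {z | 0 < z.re} := by
    intro z hz
    have := (Complex.differentiableAt_log (Or.inl hz : z ∈ Complex.slitPlane))
    exact DifferentiableAt.differentiableWithinAt (by fun_prop)
  have hreal : ∀ x : ℝ, 0 < x → mellin (fun t : ℝ => Complex.exp (-((x : ℂ) * t))) s =
      Complex.exp (-Complex.log x * s) * Complex.Gamma s := by
    intro x hx
    rw [mellin]
    simp_rw [smul_eq_mul]
    have hx' : (x : ℂ) ≠ 0 := by exact_mod_cast hx.ne'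
    rw [Complex.integral_cpow_mul_exp_neg_mul_Ioi hs hx, one_div,
      Complex.cpow_def_of_ne_zero (inv_ne_zero hx'), Complex.log_inv _
        (by rw [Complex.arg_ofReal_of_nonneg hx.le]; exact Real.pi_pos.ne)]
  refine (hdiff.analyticOnNhd hopen).eqOn_of_preconnected_of_frequently_eq
    (hdiff'.analyticOnNhd hopen) (convex_halfSpace_re_gt 0).isPreconnected
    (z₀ := 1) (by simp) ?_ hr
  have htend : Tendsto (fun x : ℝ => (x : ℂ)) (𝓝[≠] 1) (𝓝[≠] 1) := by
    refine tendsto_nhdsWithin_iff.2 ⟨?_, ?_⟩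
    · exact (Complex.continuous_ofReal.tendsto' 1 1 (by simp)).mono_left nhdsWithin_le_nhds
    · filter_upwards [self_mem_nhdsWithin] with x hx
      simpa using hx
  refine htend.frequently (Eventually.frequently ?_)
  filter_upwards [nhdsWithin_le_nhds (lt_mem_nhds one_pos)] with x hx using hreal x hx

/-- Derivatives of a Mellin transform are the Mellin transforms of `log ^ k • f`. -/
theorem iteratedDeriv_mellin_of_isBigO {f : ℝ → ℂ} (hfc : ContinuousOn f (Ioi 0))
    (hf_top : ∀ a : ℝ, f =O[atTop] (· ^ (-a)))
    (hf_bot : ∀ b : ℝ, 0 < b → f =O[𝓝[>] 0] (· ^ (-b))) (k : ℕ) {s : ℂ} (hs : 0 < s.re) :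
    iteratedDeriv k (mellin f) s = mellin (fun t => (Real.log t) ^ k • f t) s := by
  have hopen : IsOpen {z : ℂ | 0 < z.re} := isOpen_lt continuous_const Complex.continuous_re
  induction k generalizing f with
  | zero => simp
  | succ k ih =>
    have hlog : ContinuousOn (fun t => Real.log t • f t) (Ioi 0) :=
      (Real.continuousOn_log.mono (by simp)).smul hfc
    have hderiv : EqOn (deriv (mellin f)) (mellin fun t => Real.log t • f t) {z | 0 < z.re} := by
      intro z (hz : 0 < z.re)
      exact (mellin_hasDerivAt_of_isBigO_rpow (hfc.locallyIntegrableOn measurableSet_Ioi)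
        (hf_top (z.re + 1)) (by linarith) (hf_bot (z.re / 2) (by positivity))
        (by linarith)).2.deriv
    rw [iteratedDeriv_succ', hderiv.eventuallyEq_of_mem (hopen.mem_nhds hs) |>.iteratedDeriv_eq k,
      ih hlog (fun a => isBigO_rpow_top_log_smul (lt_add_one a) (hf_top _))
        (fun b hb => isBigO_rpow_zero_log_smul (half_lt_self hb) (hf_bot _ (half_pos hb)))]
    simp_rw [smul_smul, pow_succ]

theorem mellin_log_pow_smul_exp_neg_mul {s : ℂ} (hs : 0 < s.re) {r : ℂ} (hr : 0 < r.re) (k : ℕ) :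
    mellin (fun t : ℝ => (Real.log t) ^ k • Complex.exp (-(r * t))) s =
      Complex.exp (-Complex.log r * s) * ∑ i ∈ Finset.range (k + 1),
        (k.choose i : ℂ) * (-Complex.log r) ^ i * iteratedDeriv (k - i) Complex.Gamma s := by
  have hopen : IsOpen {z : ℂ | 0 < z.re} := isOpen_lt continuous_const Complex.continuous_re
  have hcont : Continuous fun t : ℝ => Complex.exp (-(r * t)) := by fun_prop
  rw [← iteratedDeriv_mellin_of_isBigO hcont.continuousOn ?_ ?_ k hs]
  · have heq : mellin (fun t : ℝ => Complex.exp (-(r * t))) =ᶠ[𝓝 s]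
        fun z => Complex.exp (-Complex.log r * z) * Complex.Gamma z := by
      filter_upwards [hopen.mem_nhds hs] with z hz using mellin_exp_neg_mul hz hr
    have hGamma : DifferentiableOn ℂ Complex.Gamma {z | 0 < z.re} := fun z (hz : 0 < z.re) =>
      (Complex.differentiableAt_Gamma z fun m h => by
        have := congrArg Complex.re h
        simp only [Complex.neg_re, Complex.natCast_re] at this
        linarith [m.cast_nonneg (α := ℝ)]).differentiableWithinAt
    rw [heq.iteratedDeriv_eq k, iteratedDeriv_fun_mul (by fun_prop)
      (hGamma.contDiffOn hopen |>.contDiffAt (hopen.mem_nhds hs)), Finset.mul_sum]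
    refine Finset.sum_congr rfl fun i _ => ?_
    rw [iteratedDeriv_cexp_const_mul]
    ring
  · intro a
    refine Asymptotics.IsBigO.trans (.of_bound 1 (.of_forall fun t => ?_))
      (isLittleO_exp_neg_mul_rpow_atTop hr (-a)).isBigO
    simp [Complex.norm_exp]
  · intro b hb
    have h1 : (fun t : ℝ => Complex.exp (-(r * t))) =O[𝓝[>] 0] fun _ => (1 : ℝ) :=
      ((hcont.tendsto 0).mono_left nhdsWithin_le_nhds).isBigO_one ℝ
    refine h1.trans (.of_bound 1 ?_)
    filter_upwards [Ioc_mem_nhdsGT one_pos] with t ht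
    have := Real.one_le_rpow_of_pos_of_le_one_of_nonpos ht.1 ht.2 (neg_nonpos.2 hb.le)
    simpa using this.trans (le_abs_self _)

/-- A polynomial in `a - x` re-expanded in powers of `x`, with its top coefficient. -/
theorem exists_coeff_sum_pow_neg_add (k : ℕ) (a : ℂ) (d : ℕ → ℂ) :
    ∃ c : ℕ → ℂ, c k = (-1) ^ k * d k ∧ ∀ x : ℂ,
      ∑ i ∈ Finset.range (k + 1), d i * (a - x) ^ i =
        ∑ i ∈ Finset.range (k + 1), c i * x ^ i := by
  let P : Polynomial ℂ :=
    ∑ i ∈ Finset.range (k + 1), Polynomial.C (d i) * (Polynomial.C a - Polynomial.X) ^ i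
  have hlin : (Polynomial.C a - Polynomial.X).natDegree ≤ 1 := by compute_degree
  have hpow (i : ℕ) :
      (Polynomial.C (d i) * (Polynomial.C a - Polynomial.X) ^ i).natDegree ≤ i :=
    (Polynomial.natDegree_C_mul_le _ _).trans
      (by simpa using Polynomial.natDegree_pow_le_of_le i hlin)
  have hdeg : P.natDegree < k + 1 := Nat.lt_succ_of_le <|
    Polynomial.natDegree_sum_le_of_forall_le _ _ fun i hi =>
      (hpow i).trans (Nat.lt_succ_iff.1 (Finset.mem_range.1 hi))
  refine ⟨P.coeff, ?_, fun x => ?_⟩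
  · have htop : ((Polynomial.C a - Polynomial.X) ^ k).coeff k = (-1) ^ k := by
      simpa using Polynomial.coeff_pow_of_natDegree_le (m := k) hlin
    rw [Polynomial.finsetSum_coeff, Finset.sum_range_succ, Finset.sum_eq_zero, zero_add,
      Polynomial.coeff_C_mul, htop, mul_comm]
    intro i hi
    exact Polynomial.coeff_eq_zero_of_natDegree_lt ((hpow i).trans_lt (Finset.mem_range.1 hi))
  · rw [← Polynomial.eval_eq_sum_range' hdeg]
    simp [P, Polynomial.eval_finsetSum]

/-- For `j ∈ ℂ` with `Re j > -1`, `k ∈ ℕ`, there exist constants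
`c 0, …, c k ∈ ℂ` (independent of `τ`), with top coefficient
`c k = e^{iπ(j+1)/2} (-1)^k Γ(j+1)`, such that for every `τ > 0` the Abel-regularized
Fourier transform `lim_{ε→0⁺} ∫_0^∞ e^{iξτ - εξ} ξ^j (log ξ)^k dξ` exists and equals
`τ^{-j-1} ∑_{κ=0}^k c κ (log τ)^κ`. -/
theorem stmt0 (j : ℂ) (hj : -1 < j.re) (k : ℕ) :
    ∃ c : ℕ → ℂ,
      c k = Complex.exp (Complex.I * Real.pi * (j + 1) / 2) * (-1) ^ k * Complex.Gamma (j + 1) ∧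
      ∀ τ : ℝ, 0 < τ →
        Tendsto
          (fun ε : ℝ => ∫ ξ in Ioi (0 : ℝ),
            Complex.exp (Complex.I * ξ * τ - ε * ξ) * Complex.exp (j * Real.log ξ) *
              (Real.log ξ : ℂ) ^ k)
          (𝓝[>] 0)
          (𝓝 (Complex.exp (-(j + 1) * Real.log τ) *
            ∑ κ ∈ Finset.range (k + 1), c κ * (Real.log τ : ℂ) ^ κ)) := by
  have hs : 0 < (j + 1).re := by simp; linarith
  obtain ⟨c, hck, hc⟩ := exists_coeff_sum_pow_neg_add k (Complex.I * Real.pi / 2) fun i =>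
    Complex.exp (Complex.I * Real.pi * (j + 1) / 2) *
      ((k.choose i : ℂ) * iteratedDeriv (k - i) Complex.Gamma (j + 1))
  refine ⟨c, ?_, fun τ hτ => ?_⟩
  · rw [hck]
    simp
    ring
  have hlog : Complex.log (-(Complex.I * τ)) = Real.log τ - Complex.I * Real.pi / 2 := by
    rw [show -(Complex.I * τ) = (τ : ℂ) * -Complex.I by ring,
      Complex.log_ofReal_mul hτ (by simp), Complex.log_neg_I]
    ring
  have hslit : -(Complex.I * τ) ∈ Complex.slitPlane :=
    Complex.mem_slitPlane_iff.2 (Or.inr (by simpa using hτ.ne'))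
  have hlim : Tendsto (fun ε : ℝ => Complex.log (ε - Complex.I * τ)) (𝓝[>] 0)
      (𝓝 (Complex.log (-(Complex.I * τ)))) := by
    refine Tendsto.clog (Tendsto.mono_left ?_ nhdsWithin_le_nhds) hslit
    exact Continuous.tendsto' (by fun_prop) _ _ (by simp)
  have hmain : Continuous fun L : ℂ => Complex.exp (-L * (j + 1)) *
      ∑ i ∈ Finset.range (k + 1),
        (k.choose i : ℂ) * (-L) ^ i * iteratedDeriv (k - i) Complex.Gamma (j + 1) := by
    fun_prop
  convert ((hmain.tendsto _).comp hlim).congr' ?_ using 2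
  · rw [← hc, hlog, Finset.mul_sum, Finset.mul_sum]
    refine Finset.sum_congr rfl fun i _ => ?_
    rw [show -((Real.log τ : ℂ) - Complex.I * Real.pi / 2) * (j + 1) =
      -(j + 1) * Real.log τ + Complex.I * Real.pi * (j + 1) / 2 by ring, Complex.exp_add]
    ring
  · filter_upwards [self_mem_nhdsWithin] with ε (hε : 0 < ε)
    rw [Function.comp_apply, ← mellin_log_pow_smul_exp_neg_mul hs (by simpa using hε), mellin]
    refine setIntegral_congr_fun measurableSet_Ioi fun ξ (hξ : 0 < ξ) => ?_
    simp only [add_sub_cancel_right, smul_eq_mul, Complex.real_smul]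
    rw [Complex.cpow_def_of_ne_zero (by exact_mod_cast hξ.ne'), ← Complex.ofReal_log hξ.le,
      show -(((ε : ℂ) - Complex.I * τ) * ξ) = Complex.I * ξ * τ - ε * ξ by ring,
      mul_comm (Real.log ξ : ℂ) j]
    push_cast
    ring
end

section
/- Let j ∈ ℂ with Re j > −1, let k ∈ ℕ, and let s ∈ {+1, −1}. Then lim_{ε→0⁺} ∫_0^∞ e^{s·iξ − εξ} ξ^j (log ξ)^k dξ = s·i · e^{s·ijπ/2} · ∫_0^∞ e^{−ξ} ξ^j (log ξ + s·iπ/2)^k dξ, where the integral on the right-hand side is absolutely convergent. -/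
open MeasureTheory Filter Set Topology

/-- The integrand `e^{-aξ} (log ξ + c)^k`, whose Mellin transform is studied below. -/
private noncomputable def expLogPow (a c : ℂ) (k : ℕ) (t : ℝ) : ℂ :=
  Complex.exp (-(a * t)) * ((Real.log t : ℂ) + c) ^ k

private lemma expLogPow_succ (a c : ℂ) (k : ℕ) :
    expLogPow a c (k + 1) =
      fun t => Real.log t • expLogPow a c k t + c * expLogPow a c k t := by
  ext t
  simp only [expLogPow, Complex.real_smul]
  ring

private lemma norm_exp_neg_mul_ofReal (a : ℂ) (t : ℝ) :
    ‖Complex.exp (-(a * t))‖ = Real.exp (-a.re * t) := by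
  simp [Complex.norm_exp]

private lemma expLogPow_isBigO_atTop {a : ℂ} (ha : 0 < a.re) (c : ℂ) (k : ℕ) (A : ℝ) :
    expLogPow a c k =O[atTop] (fun t : ℝ => t ^ (-A)) := by
  induction k generalizing A with
  | zero =>
    refine Asymptotics.IsBigO.trans ?_ (isLittleO_exp_neg_mul_rpow_atTop ha (-A)).isBigO
    refine Asymptotics.isBigO_of_le _ fun t => ?_
    simp [expLogPow, norm_exp_neg_mul_ofReal]
  | succ k ih =>
    rw [expLogPow_succ]
    exact (isBigO_rpow_top_log_smul (lt_add_one A) (ih (A + 1))).add ((ih A).const_mul_left c)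

private lemma expLogPow_isBigO_zero {a : ℂ} (ha : 0 < a.re) (c : ℂ) (k : ℕ) {b : ℝ}
    (hb : 0 < b) : expLogPow a c k =O[𝓝[>] 0] (fun t : ℝ => t ^ (-b)) := by
  induction k generalizing b with
  | zero =>
    refine Asymptotics.IsBigO.of_bound 1 ?_
    filter_upwards [Ioo_mem_nhdsGT (zero_lt_one (α := ℝ))] with t ht
    have h1 : 1 ≤ t ^ (-b) :=
      Real.one_le_rpow_of_pos_of_le_one_of_nonpos ht.1 ht.2.le (by linarith)
    simp only [expLogPow, pow_zero, mul_one, norm_exp_neg_mul_ofReal, one_mul]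
    rw [Real.norm_of_nonneg (by linarith)]
    refine le_trans (Real.exp_le_one_iff.2 ?_) h1
    nlinarith [ht.1]
  | succ k ih =>
    rw [expLogPow_succ]
    exact (isBigO_rpow_zero_log_smul (half_lt_self hb) (ih (half_pos hb))).add
      ((ih hb).const_mul_left c)

private lemma expLogPow_locallyIntegrableOn (a c : ℂ) (k : ℕ) :
    LocallyIntegrableOn (expLogPow a c k) (Ioi 0) := by
  refine ContinuousOn.locallyIntegrableOn ?_ measurableSet_Ioi
  have h : ContinuousOn (fun t : ℝ => (Real.log t : ℂ)) (Ioi 0) :=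
    Complex.continuous_ofReal.comp_continuousOn
      (Real.continuousOn_log.mono fun t ht => (mem_Ioi.1 ht).ne')
  unfold expLogPow
  fun_prop

private lemma expLogPow_mellinConvergent {a : ℂ} (ha : 0 < a.re) (c : ℂ) (k : ℕ) {w : ℂ}
    (hw : 0 < w.re) : MellinConvergent (expLogPow a c k) w :=
  mellinConvergent_of_isBigO_rpow (expLogPow_locallyIntegrableOn a c k)
    (expLogPow_isBigO_atTop ha c k (w.re + 1)) (lt_add_one _)
    (expLogPow_isBigO_zero ha c k (half_pos hw)) (half_lt_self hw)

private lemma hasDerivAt_mellin_expLogPow {a : ℂ} (ha : 0 < a.re) (c : ℂ) (k : ℕ) {w : ℂ}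
    (hw : 0 < w.re) :
    HasDerivAt (mellin (expLogPow a c k))
      (mellin (expLogPow a c (k + 1)) w - c * mellin (expLogPow a c k) w) w := by
  have h := (mellin_hasDerivAt_of_isBigO_rpow (expLogPow_locallyIntegrableOn a c k)
    (expLogPow_isBigO_atTop ha c k (w.re + 1)) (lt_add_one _)
    (expLogPow_isBigO_zero ha c k (half_pos hw)) (half_lt_self hw))
  convert! h.2 using 1
  have h2 := (hasMellin_add h.1
    ((expLogPow_mellinConvergent ha c k hw).const_smul c)).2
  rw [mellin_const_smul, smul_eq_mul] at h2
  rw [expLogPow_succ, sub_eq_iff_eq_add, ← h2]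
  rfl

private lemma expLogPow_zero_zero (a : ℂ) (t : ℝ) :
    expLogPow a 0 0 t = Complex.exp (-(a * t)) := by simp [expLogPow]

private lemma hasDerivAt_mellin_expLogPow_rate {a : ℂ} (ha : 0 < a.re) {w : ℂ}
    (hw : 0 < w.re) :
    HasDerivAt (fun b => mellin (expLogPow b 0 0) w) (-mellin (expLogPow a 0 0) (w + 1)) a := by
  have hw' : 0 < (w + 1).re := by simpa using by linarith
  have hs : {b : ℂ | a.re / 2 < b.re} ∈ 𝓝 a :=
    (isOpen_lt continuous_const Complex.continuous_re).mem_nhds (half_lt_self ha)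
  have hpow : ∀ t ∈ Ioi (0 : ℝ), (t : ℂ) ^ (w + 1 - 1) = (t : ℂ) ^ (w - 1) * t := fun t ht => by
    have ht0 : (t : ℂ) ≠ 0 := by exact_mod_cast (mem_Ioi.1 ht).ne'
    rw [add_sub_right_comm, Complex.cpow_add _ _ ht0, Complex.cpow_one]
  have hint : ∀ {b : ℂ}, 0 < b.re → ∀ {z : ℂ}, 0 < z.re → IntegrableOn
      (fun t : ℝ => (t : ℂ) ^ (z - 1) • expLogPow b 0 0 t) (Ioi 0) :=
    fun hb _ hz => expLogPow_mellinConvergent hb 0 0 hz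
  have hb2 : 0 < ((a.re / 2 : ℝ) : ℂ).re := by simpa using ha
  have h := hasDerivAt_integral_of_dominated_loc_of_deriv_le (μ := volume.restrict (Ioi (0 : ℝ)))
    (F := fun b t => (t : ℂ) ^ (w - 1) • expLogPow b 0 0 t)
    (F' := fun b t => -((t : ℂ) ^ (w + 1 - 1) • expLogPow b 0 0 t))
    (bound := fun t => ‖(t : ℂ) ^ (w + 1 - 1) • expLogPow (a.re / 2 : ℝ) 0 0 t‖)
    hs ?_ (hint ha hw) (hint ha hw').neg.aestronglyMeasurable ?_ (hint hb2 hw').norm ?_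
  · convert! h.2 using 1
    exact (integral_neg _).symm
  · filter_upwards [hs] with b hb
    exact (hint ((half_pos ha).trans hb) hw).aestronglyMeasurable
  · refine (ae_restrict_mem measurableSet_Ioi).mono fun t ht b hb => ?_
    simp only [norm_neg, norm_smul, expLogPow_zero_zero, norm_exp_neg_mul_ofReal,
      Complex.ofReal_re]
    gcongr
    · exact (mem_Ioi.1 ht).le
    · exact le_of_lt hb
  · refine (ae_restrict_mem measurableSet_Ioi).mono fun t ht b _ => ?_
    simp only [expLogPow_zero_zero, smul_eq_mul, hpow t ht]
    have := ((((hasDerivAt_id b).mul_const (t : ℂ)).neg).cexp).const_mul ((t : ℂ) ^ (w - 1))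
    convert! this using 1
    simp only [Pi.neg_apply, id]
    ring

/-- The Gamma integral with a complex rate `a` in the right half-plane. -/
private lemma mellin_exp_neg_mul_s2 {a : ℂ} (ha : 0 < a.re) {w : ℂ} (hw : 0 < w.re) :
    mellin (expLogPow a 0 0) w = Complex.exp (-(Complex.log a * w)) * Complex.Gamma w := by
  have hopen : IsOpen {b : ℂ | 0 < b.re} := isOpen_lt continuous_const Complex.continuous_re
  have hf : AnalyticOnNhd ℂ (fun b => mellin (expLogPow b 0 0) w) {b : ℂ | 0 < b.re} :=
    DifferentiableOn.analyticOnNhd (fun b hb =>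
      (hasDerivAt_mellin_expLogPow_rate hb hw).differentiableAt.differentiableWithinAt) hopen
  have hg : AnalyticOnNhd ℂ (fun b => Complex.exp (-(Complex.log b * w)) * Complex.Gamma w)
      {b : ℂ | 0 < b.re} :=
    DifferentiableOn.analyticOnNhd (fun b hb =>
      ((((Complex.differentiableAt_log (Or.inl hb)).mul_const w).neg.cexp).mul_const
        _).differentiableWithinAt) hopen
  have hreal : ∀ r : ℝ, 0 < r → mellin (expLogPow r 0 0) w =
      Complex.exp (-(Complex.log r * w)) * Complex.Gamma w := fun r hr => by
    have h := Complex.integral_cpow_mul_exp_neg_mul_Ioi hw hr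
    simp only [mellin, expLogPow_zero_zero, smul_eq_mul]
    rw [h, one_div, Complex.cpow_def_of_ne_zero (by simpa using hr.ne'), ← Complex.ofReal_inv,
      ← Complex.ofReal_log (by positivity), ← Complex.ofReal_log hr.le, Real.log_inv]
    simp
  refine hf.eqOn_of_preconnected_of_frequently_eq hg
    (convex_halfSpace_re_gt 0).isPreconnected (z₀ := 1) (by simp) ?_ ha
  have htend : Tendsto (fun r : ℝ => (r : ℂ)) (𝓝[≠] 1) (𝓝[≠] 1) := by
    refine tendsto_nhdsWithin_iff.2 ⟨?_, ?_⟩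
    · exact (Complex.continuous_ofReal.tendsto' 1 1 (by simp)).mono_left nhdsWithin_le_nhds
    · filter_upwards [self_mem_nhdsWithin] with r hr
      simpa using hr
  refine htend.frequently (Eventually.frequently ?_)
  filter_upwards [nhdsWithin_le_nhds (lt_mem_nhds (zero_lt_one (α := ℝ)))] with r hr
  exact hreal r hr

/-- Rotating the contour: replacing `e^{-aξ}` by `e^{-ξ}` shifts `log ξ` by `-log a`. -/
private lemma mellin_expLogPow_rotate {a : ℂ} (ha : 0 < a.re) (k : ℕ) {w : ℂ}
    (hw : 0 < w.re) :
    mellin (expLogPow a 0 k) w =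
      Complex.exp (-(Complex.log a * w)) * mellin (expLogPow 1 (-Complex.log a) k) w := by
  induction k generalizing w with
  | zero =>
    have h : expLogPow 1 (-Complex.log a) 0 = expLogPow 1 0 0 := by
      ext t
      simp [expLogPow]
    rw [mellin_exp_neg_mul_s2 ha hw, h, mellin_exp_neg_mul_s2 (by simp) hw]
    simp
  | succ k ih =>
    set L := Complex.log a
    have hl := hasDerivAt_mellin_expLogPow ha 0 k hw
    have hr := hasDerivAt_mellin_expLogPow (a := 1) (by simp) (-L) k hw
    have he : HasDerivAt (fun z : ℂ => Complex.exp (-(L * z)))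
        (Complex.exp (-(L * w)) * -(L * 1)) w :=
      (((hasDerivAt_id w).const_mul L).neg).cexp
    have heq : mellin (expLogPow a 0 k) =ᶠ[𝓝 w]
        fun z => Complex.exp (-(L * z)) * mellin (expLogPow 1 (-L) k) z := by
      filter_upwards [(isOpen_lt continuous_const Complex.continuous_re).mem_nhds hw] with z hz
      exact ih hz
    have := hl.unique ((he.mul hr).congr_of_eventuallyEq heq)
    linear_combination this

private lemma continuous_mellin_expLogPow {a : ℂ} (ha : 0 < a.re) (k : ℕ) {w : ℂ}
    (hw : 0 < w.re) : Continuous fun c => mellin (expLogPow a c k) w := by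
  have h : ∀ c, mellin (expLogPow a c k) w = ∑ m ∈ Finset.range (k + 1),
      mellin (expLogPow a 0 m) w * (c ^ (k - m) * (k.choose m : ℂ)) := fun c => by
    simp only [mellin, ← integral_mul_const]
    rw [← integral_finsetSum]
    · refine integral_congr_ae (Eventually.of_forall fun t => ?_)
      simp only [expLogPow, add_pow, add_zero, smul_eq_mul, Finset.mul_sum]
      exact Finset.sum_congr rfl fun m _ => by ring
    · exact fun m _ => (expLogPow_mellinConvergent ha 0 m hw).mul_const _
  simp only [h]
  fun_prop

private lemma mellin_integrand_eq {j : ℂ} (f : ℝ → ℂ) {t : ℝ} (ht : 0 < t) :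
    (t : ℂ) ^ (j + 1 - 1) • f t = Complex.exp (j * Real.log t) * f t := by
  rw [add_sub_cancel_right, Complex.cpow_def_of_ne_zero (by exact_mod_cast ht.ne'),
    ← Complex.ofReal_log ht.le, smul_eq_mul, mul_comm j]

/-- For `j ∈ ℂ` with `Re j > -1`, `k ∈ ℕ`, and `s ∈ {+1, -1}`,
`lim_{ε→0⁺} ∫_0^∞ e^{s·iξ - εξ} ξ^j (log ξ)^k dξ
  = s·i · e^{s·ijπ/2} · ∫_0^∞ e^{-ξ} ξ^j (log ξ + s·iπ/2)^k dξ`,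
the right-hand integral being absolutely convergent. -/
theorem stmt2 (j : ℂ) (hj : -1 < j.re) (k : ℕ) (s : ℝ) (hs : s = 1 ∨ s = -1) :
    IntegrableOn
      (fun ξ : ℝ => Complex.exp (-ξ) * Complex.exp (j * Real.log ξ) *
        ((Real.log ξ : ℂ) + s * Complex.I * Real.pi / 2) ^ k) (Ioi 0) ∧
    Tendsto
      (fun ε : ℝ => ∫ ξ in Ioi (0 : ℝ),
        Complex.exp (s * Complex.I * ξ - ε * ξ) * Complex.exp (j * Real.log ξ) *
          (Real.log ξ : ℂ) ^ k)
      (𝓝[>] 0)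
      (𝓝 ((s : ℂ) * Complex.I * Complex.exp (s * Complex.I * j * Real.pi / 2) *
        ∫ ξ in Ioi (0 : ℝ),
          Complex.exp (-ξ) * Complex.exp (j * Real.log ξ) *
            ((Real.log ξ : ℂ) + s * Complex.I * Real.pi / 2) ^ k)) := by
  have hw : 0 < (j + 1).re := by simpa using by linarith
  have hrhs : ∀ t ∈ Ioi (0 : ℝ), (t : ℂ) ^ (j + 1 - 1) •
      expLogPow 1 (s * Complex.I * Real.pi / 2) k t = Complex.exp (-t) * Complex.exp (j * Real.log t) *
        ((Real.log t : ℂ) + s * Complex.I * Real.pi / 2) ^ k := fun t ht => by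
    rw [mellin_integrand_eq _ ht, expLogPow, one_mul]
    ring
  have hlhs : ∀ ε : ℝ, ∀ t ∈ Ioi (0 : ℝ), (t : ℂ) ^ (j + 1 - 1) •
      expLogPow (ε - s * Complex.I) 0 k t = Complex.exp (s * Complex.I * t - ε * t) * Complex.exp (j * Real.log t) *
          (Real.log t : ℂ) ^ k := fun ε t ht => by
    rw [mellin_integrand_eq _ ht, expLogPow, add_zero,
      show -(((ε : ℂ) - s * Complex.I) * t) = s * Complex.I * t - ε * t by ring]
    ring
  refine ⟨(expLogPow_mellinConvergent (by simp) _ k hw).congr_fun hrhs measurableSet_Ioi, ?_⟩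
  rw [← setIntegral_congr_fun measurableSet_Ioi hrhs]
  have hlog0 : Complex.log (-(s * Complex.I)) = -(s * Complex.I * Real.pi / 2) := by
    rcases hs with rfl | rfl
    · simp [Complex.log_neg_I]; ring
    · simp [Complex.log_I]; ring
  have hlog : Tendsto (fun ε : ℝ => Complex.log (ε - s * Complex.I)) (𝓝[>] 0)
      (𝓝 (-(s * Complex.I * Real.pi / 2))) := by
    rw [← hlog0]
    have hmem : -((s : ℂ) * Complex.I) ∈ Complex.slitPlane := by
      rcases hs with rfl | rfl <;> simp [Complex.mem_slitPlane_iff]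
    refine (continuousAt_clog hmem).tendsto.comp ?_
    have : Tendsto (fun ε : ℝ => (ε : ℂ) - s * Complex.I) (𝓝 0)
        (𝓝 (((0 : ℝ) : ℂ) - s * Complex.I)) := Continuous.tendsto (by fun_prop) 0
    simpa using this.mono_left nhdsWithin_le_nhds
  have hexp : Complex.exp (-(-(s * Complex.I * Real.pi / 2) * (j + 1))) =
      s * Complex.I * Complex.exp (s * Complex.I * j * Real.pi / 2) := by
    rw [show -(-(s * Complex.I * Real.pi / 2) * (j + 1)) =
      s * (Real.pi / 2 * Complex.I) + s * Complex.I * j * Real.pi / 2 by ring, Complex.exp_add]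
    congr 1
    rcases hs with rfl | rfl
    · simp [Complex.exp_pi_div_two_mul_I]
    · simp [Complex.exp_neg, Complex.exp_pi_div_two_mul_I]
  have hcont : Continuous fun L : ℂ =>
      Complex.exp (-(L * (j + 1))) * mellin (expLogPow 1 (-L) k) (j + 1) :=
    (by fun_prop : Continuous fun L : ℂ => Complex.exp (-(L * (j + 1)))).mul
      ((continuous_mellin_expLogPow (by simp) k hw).comp continuous_neg)
  have hlim := (hcont.tendsto _).comp hlog
  rw [hexp, neg_neg] at hlim
  refine hlim.congr' ?_
  filter_upwards [self_mem_nhdsWithin] with ε hε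
  rw [← setIntegral_congr_fun measurableSet_Ioi (hlhs ε)]
  exact (mellin_expLogPow_rotate (by simpa using hε) k hw).symm
end

section
/- For every z ∈ ℂ with Re z > 0 and every k ∈ ℕ, the k-th iterated complex derivative of the Gamma function at z equals ∫_0^∞ e^{−t} t^{z−1} (log t)^k dt, and this integral is absolutely convergent. -/
open MeasureTheory Filter Set Topology

/-- The function whose Mellin transform is the `k`-th derivative of the Gamma function. -/
noncomputable def logPowExp (k : ℕ) (t : ℝ) : ℂ :=
  (Real.log t : ℂ) ^ k * (Real.exp (-t) : ℂ)

theorem logPowExp_succ (k : ℕ) :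
    logPowExp (k + 1) = fun t : ℝ => Real.log t • logPowExp k t := by
  funext t
  simp only [logPowExp, Complex.real_smul]
  ring

theorem locallyIntegrableOn_logPowExp (k : ℕ) :
    LocallyIntegrableOn (logPowExp k) (Ioi 0) := by
  refine ContinuousOn.locallyIntegrableOn ?_ measurableSet_Ioi
  have hlog : ContinuousOn (fun t : ℝ => (Real.log t : ℂ)) (Ioi 0) :=
    Complex.continuous_ofReal.comp_continuousOn
      (Real.continuousOn_log.mono fun t ht => (mem_Ioi.mp ht).ne')
  exact (hlog.pow k).mul (by fun_prop)

theorem logPowExp_isBigO_atTop (k : ℕ) (a : ℝ) :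
    logPowExp k =O[atTop] fun t : ℝ => t ^ (-a) := by
  induction k generalizing a with
  | zero =>
    rw [← Asymptotics.isBigO_norm_left]
    simp only [logPowExp, pow_zero, one_mul, Complex.norm_real]
    rw [Asymptotics.isBigO_norm_left]
    simpa only [neg_one_mul] using (isLittleO_exp_neg_mul_rpow_atTop zero_lt_one (-a)).isBigO
  | succ k ih =>
    rw [logPowExp_succ]
    exact isBigO_rpow_top_log_smul (lt_add_one a) (ih (a + 1))

theorem logPowExp_isBigO_nhdsGT_zero (k : ℕ) {b : ℝ} (hb : 0 < b) :
    logPowExp k =O[𝓝[>] 0] fun t : ℝ => t ^ (-b) := by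
  induction k generalizing b with
  | zero =>
    have h : logPowExp 0 =O[𝓝[>] 0] fun t : ℝ => t ^ (-(0 : ℝ)) := by
      simp_rw [neg_zero, Real.rpow_zero]
      refine Asymptotics.isBigO_const_of_tendsto (y := (1 : ℂ)) ?_ one_ne_zero
      have hc : Continuous (logPowExp 0) := by
        unfold logPowExp
        simp only [pow_zero, one_mul]
        fun_prop
      simpa [logPowExp] using hc.continuousWithinAt (s := Ioi 0) (x := 0) |>.tendsto
    refine h.trans (Asymptotics.IsBigO.of_bound 1 ?_)
    filter_upwards [Ioo_mem_nhdsGT (zero_lt_one (α := ℝ))] with t ht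
    rw [one_mul, Real.norm_of_nonneg (Real.rpow_nonneg ht.1.le _),
      Real.norm_of_nonneg (Real.rpow_nonneg ht.1.le _)]
    exact Real.rpow_le_rpow_of_exponent_ge ht.1 ht.2.le (by linarith)
  | succ k ih =>
    rw [logPowExp_succ]
    exact isBigO_rpow_zero_log_smul (half_lt_self hb) (ih (half_pos hb))

theorem mellinConvergent_logPowExp (k : ℕ) {s : ℂ} (hs : 0 < s.re) :
    MellinConvergent (logPowExp k) s :=
  mellinConvergent_of_isBigO_rpow (locallyIntegrableOn_logPowExp k)
    (logPowExp_isBigO_atTop k (s.re + 1)) (lt_add_one _)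
    (logPowExp_isBigO_nhdsGT_zero k (half_pos hs)) (half_lt_self hs)

theorem hasDerivAt_mellin_logPowExp (k : ℕ) {s : ℂ} (hs : 0 < s.re) :
    HasDerivAt (mellin (logPowExp k)) (mellin (logPowExp (k + 1)) s) s := by
  rw [logPowExp_succ]
  exact (mellin_hasDerivAt_of_isBigO_rpow (locallyIntegrableOn_logPowExp k)
    (logPowExp_isBigO_atTop k (s.re + 1)) (lt_add_one _)
    (logPowExp_isBigO_nhdsGT_zero k (half_pos hs)) (half_lt_self hs)).2

theorem iteratedDeriv_Gamma_eq_mellin (k : ℕ) {s : ℂ} (hs : 0 < s.re) :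
    iteratedDeriv k Complex.Gamma s = mellin (logPowExp k) s := by
  induction k generalizing s with
  | zero =>
    rw [iteratedDeriv_zero, Complex.Gamma_eq_integral hs, Complex.GammaIntegral_eq_mellin]
    congr 1
    funext t
    simp [logPowExp]
  | succ k ih =>
    have hopen : IsOpen {w : ℂ | 0 < w.re} := isOpen_lt continuous_const Complex.continuous_re
    have heq : iteratedDeriv k Complex.Gamma =ᶠ[𝓝 s] mellin (logPowExp k) := by
      filter_upwards [hopen.mem_nhds hs] with w hw using ih hw
    rw [iteratedDeriv_succ, heq.deriv_eq, (hasDerivAt_mellin_logPowExp k hs).deriv]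

theorem cpow_smul_logPowExp (z : ℂ) (k : ℕ) {t : ℝ} (ht : t ∈ Ioi (0 : ℝ)) :
    (t : ℂ) ^ (z - 1) • logPowExp k t =
      Complex.exp (-t) * Complex.exp ((z - 1) * Real.log t) * (Real.log t : ℂ) ^ k := by
  have ht' : (0 : ℝ) < t := ht
  rw [Complex.cpow_def_of_ne_zero (Complex.ofReal_ne_zero.mpr ht'.ne'),
    ← Complex.ofReal_log ht'.le, logPowExp, smul_eq_mul, Complex.ofReal_exp, Complex.ofReal_neg,
    mul_comm (Real.log t : ℂ) (z - 1)]
  ring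

/-- For `z ∈ ℂ` with `Re z > 0` and `k ∈ ℕ`, the `k`-th iterated complex
derivative of the Gamma function at `z` equals `∫_0^∞ e^{-t} t^{z-1} (log t)^k dt`, and the
integral is absolutely convergent. -/
theorem stmt3 (z : ℂ) (hz : 0 < z.re) (k : ℕ) :
    IntegrableOn
      (fun t : ℝ => Complex.exp (-t) * Complex.exp ((z - 1) * Real.log t) *
        (Real.log t : ℂ) ^ k) (Ioi 0) ∧
    iteratedDeriv k Complex.Gamma z =
      ∫ t in Ioi (0 : ℝ),
        Complex.exp (-t) * Complex.exp ((z - 1) * Real.log t) * (Real.log t : ℂ) ^ k := by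
  refine ⟨(mellinConvergent_logPowExp k hz).congr_fun
    (fun t ht => cpow_smul_logPowExp z k ht) measurableSet_Ioi, ?_⟩
  rw [iteratedDeriv_Gamma_eq_mellin k hz, mellin]
  exact setIntegral_congr_fun measurableSet_Ioi fun t ht => cpow_smul_logPowExp z k ht
end

section
/- For all j, k ∈ ℕ and all r₀, σ₀ > 0, there exists a constant C > 0 such that for all t > 0, all r ≥ r₀, and all σ ≥ σ₀, one has |∂_σ^j ∂_r^k ( σ/(2σt + r) )| ≤ C ⟨σ⟩ / ⟨t + r⟩^{k+1}. -/
/-- The iterated derivatives of an integer power of an affine function. -/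
theorem iteratedDeriv_affine_zpow (n : ℕ) (m : ℤ) (a b : ℝ) :
    iteratedDeriv n (fun x : ℝ => (a * x + b) ^ m) =
      fun x => (∏ i ∈ Finset.range n, ((m : ℝ) - i)) * a ^ n * (a * x + b) ^ (m - n) := by
  have deriv_affine (p : ℤ) (x : ℝ) :
      deriv (fun x : ℝ => (a * x + b) ^ p) x = a * (p * (a * x + b) ^ (p - 1)) := by
    have h := deriv_comp_mul_left a (fun y : ℝ => (y + b) ^ p) x
    rw [h, deriv_comp_add_const (f := fun y : ℝ => y ^ p), deriv_zpow, smul_eq_mul]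
  induction n with
  | zero => simp
  | succ n ih =>
    funext x
    rw [iteratedDeriv_succ, ih, deriv_const_mul_field, deriv_affine, Finset.prod_range_succ,
      show m - ((n + 1 : ℕ) : ℤ) = m - n - 1 by push_cast; ring]
    push_cast
    ring

/-- If the slope `a` of an affine function with value `u = a * x + b` satisfies `a * c ≤ u`, then
differentiating `u ^ m` does not increase its size by more than a factor of `c⁻¹` each time. -/
theorem abs_iteratedDeriv_affine_zpow_le (n : ℕ) (m : ℤ) {a b c x : ℝ} (ha : 0 ≤ a) (hc : 0 < c)
    (hu : 0 < a * x + b) (h : a * c ≤ a * x + b) :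
    |iteratedDeriv n (fun x : ℝ => (a * x + b) ^ m) x| ≤
      |∏ i ∈ Finset.range n, ((m : ℝ) - i)| * c⁻¹ ^ n * (a * x + b) ^ m := by
  simp only [iteratedDeriv_affine_zpow]
  generalize a * x + b = u at hu h ⊢
  have hau : a / u ≤ c⁻¹ := by
    rw [div_le_iff₀ hu, inv_mul_eq_div, le_div_iff₀ hc]
    exact h
  have hpow : a ^ n * u ^ (m - n) = (a / u) ^ n * u ^ m := by
    rw [zpow_sub₀ hu.ne', zpow_natCast, div_pow]
    ring
  rw [mul_assoc, hpow, abs_mul, mul_assoc, abs_of_nonneg (by positivity : 0 ≤ (a / u) ^ n * u ^ m)]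
  gcongr

theorem abs_iteratedDeriv_id_le (n : ℕ) (x : ℝ) :
    |iteratedDeriv n (fun y : ℝ => y) x| ≤ √(1 + x ^ 2) := by
  rw [iteratedDeriv_fun_id]
  split_ifs
  · exact Real.abs_le_sqrt (by linarith)
  · rw [abs_one]
    exact Real.one_le_sqrt.2 (by nlinarith)
  · simp

theorem iteratedDeriv_const_div_add (k : ℕ) (c b r : ℝ) :
    iteratedDeriv k (fun x : ℝ => c / (b + x)) r =
      (∏ i ∈ Finset.range k, (-1 - i : ℝ)) * (c * (b + r) ^ (-1 - k : ℤ)) := by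
  have h := iteratedDeriv_affine_zpow k (-1) 1 b
  have hf : (fun x : ℝ => c / (b + x)) = fun x => c * (1 * x + b) ^ (-1 : ℤ) := by
    funext x
    rw [zpow_neg_one, div_eq_mul_inv, one_mul, add_comm]
  rw [hf, iteratedDeriv_const_mul_field, h]
  simp only [one_mul, one_pow, mul_one, add_comm r b]
  push_cast
  ring

theorem sqrt_one_add_sq_le_mul {r₀ s : ℝ} (hr₀ : 0 < r₀) (hs : r₀ ≤ s) :
    √(1 + s ^ 2) ≤ (1 + r₀⁻¹) * s := by
  have h1 : 1 ≤ r₀⁻¹ * s := by rwa [inv_mul_eq_div, one_le_div hr₀]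
  have hs0 : 0 < s := hr₀.trans_le hs
  rw [Real.sqrt_le_left (by positivity)]
  nlinarith

theorem stmt4 (j k : ℕ) (r₀ σ₀ : ℝ) (hr₀ : 0 < r₀) (hσ₀ : 0 < σ₀) :
    ∃ C > 0, ∀ t : ℝ, 0 < t → ∀ r : ℝ, r₀ ≤ r → ∀ σ : ℝ, σ₀ ≤ σ →
      |iteratedDeriv j
          (fun σ' : ℝ => iteratedDeriv k (fun r' : ℝ => σ' / (2 * σ' * t + r')) r) σ| ≤
        C * Real.sqrt (1 + σ ^ 2) / Real.sqrt (1 + (t + r) ^ 2) ^ (k + 1) := by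
  set P : ℝ := ∏ i ∈ Finset.range k, (-1 - i : ℝ)
  set Q : ℕ → ℝ := fun n => |∏ i ∈ Finset.range n, (((-1 - k : ℤ) : ℝ) - i)| * σ₀⁻¹ ^ n
  set S : ℝ := ∑ i ∈ Finset.range (j + 1), j.choose i * Q (j - i) with hS
  set L : ℝ := (1 + r₀⁻¹) * (1 + (2 * σ₀)⁻¹) with hL
  have hQ0 (n : ℕ) : 0 ≤ Q n := by positivity
  have hS0 : 0 ≤ S := Finset.sum_nonneg fun i _ => mul_nonneg (by positivity) (hQ0 _)
  refine ⟨|P| * S * L ^ (k + 1) + 1, by positivity, fun t ht r hr σ hσ => ?_⟩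
  have hr0 : 0 < r := hr₀.trans_le hr
  have hσ0 : 0 < σ := hσ₀.trans_le hσ
  have hu : 0 < 2 * t * σ + r := by positivity
  have hslope : 2 * t * σ₀ ≤ 2 * t * σ + r := by nlinarith
  have hfun : (fun σ' : ℝ => iteratedDeriv k (fun r' : ℝ => σ' / (2 * σ' * t + r')) r) =
      fun σ' => P * (σ' * (2 * t * σ' + r) ^ (-1 - k : ℤ)) := by
    funext x
    rw [iteratedDeriv_const_div_add, mul_right_comm 2 x t]
  have hsmooth : ContDiffAt ℝ j (fun x : ℝ => (2 * t * x + r) ^ (-1 - k : ℤ)) σ := by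
    have h : (fun x : ℝ => (2 * t * x + r) ^ (-1 - k : ℤ)) =
        fun x => ((2 * t * x + r) ^ (k + 1))⁻¹ := by
      funext x
      rw [show (-1 - k : ℤ) = -((k + 1 : ℕ) : ℤ) by push_cast; ring, zpow_neg, zpow_natCast]
    rw [h]
    exact ContDiffAt.inv (by fun_prop) (pow_ne_zero _ hu.ne')
  have hprod : |iteratedDeriv j (fun x : ℝ => x * (2 * t * x + r) ^ (-1 - k : ℤ)) σ| ≤
      S * √(1 + σ ^ 2) * (2 * t * σ + r) ^ (-1 - k : ℤ) := by
    rw [iteratedDeriv_fun_mul (f := fun x => x) contDiffAt_id hsmooth, hS, Finset.sum_mul, Finset.sum_mul]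
    refine (Finset.abs_sum_le_sum_abs _ _).trans (Finset.sum_le_sum fun i _ => ?_)
    rw [abs_mul, abs_mul, Nat.abs_cast]
    calc _ ≤ (j.choose i : ℝ) * √(1 + σ ^ 2) * (Q (j - i) * (2 * t * σ + r) ^ (-1 - k : ℤ)) := by
          gcongr
          · exact abs_iteratedDeriv_id_le i σ
          · exact abs_iteratedDeriv_affine_zpow_le (j - i) _ (by positivity) hσ₀ hu hslope
      _ = _ := by ring
  have hbracket : √(1 + (t + r) ^ 2) ≤ L * (2 * t * σ + r) := by
    have ht' : t ≤ (2 * σ₀)⁻¹ * (2 * t * σ + r) := by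
      rw [inv_mul_eq_div, le_div_iff₀ (by positivity)]
      linarith
    have hle : t + r ≤ (1 + (2 * σ₀)⁻¹) * (2 * t * σ + r) := by
      have : 0 < t * σ := by positivity
      linarith
    calc _ ≤ (1 + r₀⁻¹) * (t + r) := sqrt_one_add_sq_le_mul hr₀ (by linarith)
      _ ≤ (1 + r₀⁻¹) * ((1 + (2 * σ₀)⁻¹) * (2 * t * σ + r)) := by gcongr
      _ = _ := by rw [hL]; ring
  have hdecay : (2 * t * σ + r) ^ (-1 - k : ℤ) ≤ L ^ (k + 1) / √(1 + (t + r) ^ 2) ^ (k + 1) := by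
    rw [show (-1 - k : ℤ) = -((k + 1 : ℕ) : ℤ) by push_cast; ring, zpow_neg, zpow_natCast,
      le_div_iff₀ (by positivity), inv_mul_eq_div, div_le_iff₀ (by positivity), ← mul_pow]
    gcongr
  rw [hfun, iteratedDeriv_const_mul_field, abs_mul]
  calc _ ≤ |P| * (S * √(1 + σ ^ 2) * (L ^ (k + 1) / √(1 + (t + r) ^ 2) ^ (k + 1))) := by
        gcongr
        exact hprod.trans (by gcongr)
    _ = |P| * S * L ^ (k + 1) * √(1 + σ ^ 2) / √(1 + (t + r) ^ 2) ^ (k + 1) := by ring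
    _ ≤ _ := by
        gcongr
        linarith
end

section
/- Let ψ ∈ C_c^∞(ℝ) be identically equal to 1 on some neighborhood of 0, and let φ be a Schwartz function on ℝ. Then for every N ∈ ℕ there exists C > 0 (depending only on ψ, N, and finitely many Schwartz seminorms of φ) such that for all t ≥ 1 and all a ∈ ℝ: |∫_{−∞}^{∞} e^{itδ²} ψ(δ) φ(a+δ) dδ − Σ_{j=0}^{N} [Γ(j+1/2)/(2j)!] · (−it)^{−j−1/2} · φ^{(2j)}(a)| ≤ C t^{−N−1}, where φ^{(2j)} denotes the (2j)-th derivative of φ. -/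
open MeasureTheory Filter Set Topology

open scoped FourierTransform

/-- `Γ(j + 1/2) / (2j)! = √π / (4 ^ j j!)`. -/
theorem gamma_add_half_div_factorial (j : ℕ) :
    Complex.Gamma ((j : ℂ) + 1 / 2) / (Nat.factorial (2 * j) : ℂ) =
      (√Real.pi : ℂ) / (4 ^ j * (Nat.factorial j : ℂ)) := by
  induction j with
  | zero =>
    have := Complex.Gamma_one_half_eq
    simp [-one_div, this, Real.sqrt_eq_rpow, Complex.ofReal_cpow Real.pi_nonneg]
  | succ j ih =>
    have h : ((j : ℂ) + 1 / 2) ≠ 0 := by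
      intro h
      have := congrArg Complex.re h
      norm_num at this
      linarith [(Nat.cast_nonneg j : (0 : ℝ) ≤ j)]
    have e : (((j + 1 : ℕ) : ℂ) + 1 / 2) = ((j : ℂ) + 1 / 2) + 1 := by push_cast; ring
    have h1 : (Nat.factorial (2 * j) : ℂ) ≠ 0 := by exact_mod_cast Nat.factorial_ne_zero _
    have h2 : (Nat.factorial j : ℂ) ≠ 0 := by exact_mod_cast Nat.factorial_ne_zero _
    have h3 : (j : ℂ) + 1 ≠ 0 := Nat.cast_add_one_ne_zero j
    have h4 : (j : ℂ) * 2 + 1 ≠ 0 := by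
      exact_mod_cast Nat.succ_ne_zero (j * 2)
    rw [e, Complex.Gamma_add_one _ h, show 2 * (j + 1) = 2 * j + 1 + 1 by ring,
      Nat.factorial_succ, Nat.factorial_succ, Nat.factorial_succ]
    rw [div_eq_iff h1] at ih
    rw [ih]
    push_cast
    rw [show 2 * (j : ℂ) + 1 + 1 = 2 * (j + 1) by ring, mul_comm 2 (j : ℂ)]
    field_simp
    ring

/-- Taylor bound for `exp` on the closed left half-plane. -/
theorem norm_exp_sub_taylor_le {z : ℂ} (hz : z.re ≤ 0) (n : ℕ) :
    ‖Complex.exp z - ∑ m ∈ Finset.range n, z ^ m / (m.factorial : ℂ)‖ ≤ (n + 3) * ‖z‖ ^ n := by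
  rcases le_total ‖z‖ 1 with h | h
  · refine (Complex.norm_exp_sub_sum_le_norm_mul_exp z n).trans ?_
    rw [mul_comm]
    gcongr
    have := Real.exp_le_exp.2 h
    have := Real.exp_one_lt_d9
    have := (Nat.cast_nonneg n : (0 : ℝ) ≤ n)
    linarith
  · have h1 : ‖Complex.exp z‖ ≤ 1 := by
      rw [Complex.norm_exp]; exact Real.exp_le_one_iff.2 hz
    have h2 : ‖∑ m ∈ Finset.range n, z ^ m / (m.factorial : ℂ)‖ ≤ n * ‖z‖ ^ n := by
      refine (norm_sum_le_of_le (f := fun m => z ^ m / (m.factorial : ℂ))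
        (n := fun _ => ‖z‖ ^ n) (Finset.range n) fun m hm => ?_).trans (by simp)
      rw [norm_div, norm_pow, Complex.norm_natCast]
      refine (div_le_self (by positivity) ?_).trans
        (pow_le_pow_right₀ h (Finset.mem_range.1 hm).le)
      exact_mod_cast Nat.factorial_pos m
    have h3 : 1 ≤ ‖z‖ ^ n := one_le_pow₀ h
    refine (norm_sub_le _ _).trans ?_
    nlinarith

/-- Parseval's identity against a complex Gaussian. -/
theorem integral_cexp_neg_mul_sq_mul_eq {b : ℂ} (hb : 0 < b.re) {f : ℝ → ℂ} (hf : Integrable f) :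
    ∫ x : ℝ, Complex.exp (-b * x ^ 2) * f x =
      (√Real.pi : ℂ) * b ^ (-(1 / 2) : ℂ) *
        ∫ ξ : ℝ, Complex.exp (-(Real.pi ^ 2 / b) * ξ ^ 2) * 𝓕 f ξ := by
  have hb0 : b ≠ 0 := by rintro rfl; simp at hb
  have hπ : (Real.pi : ℂ) ≠ 0 := by exact_mod_cast Real.pi_ne_zero
  have hinv : 0 < (b⁻¹).re := by
    rw [Complex.inv_re]; exact div_pos hb (Complex.normSq_pos.2 hb0)
  have hc : 0 < ((Real.pi : ℂ) / b).re := by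
    rw [div_eq_mul_inv, Complex.re_ofReal_mul]; exact mul_pos Real.pi_pos hinv
  have hc2 : 0 < ((Real.pi : ℂ) ^ 2 / b).re := by
    rw [div_eq_mul_inv, ← Complex.ofReal_pow, Complex.re_ofReal_mul]
    exact mul_pos (by positivity) hinv
  have hg : Integrable (fun x : ℝ => Complex.exp (-Real.pi * (Real.pi / b) * x ^ 2)) := by
    convert integrable_cexp_neg_mul_sq hc2 using 4
    ring
  have key := VectorFourier.integral_fourierIntegral_smul_eq_flip (L := innerₗ ℝ)
    (μ := volume) (ν := volume) Real.continuous_fourierChar continuous_inner hg hf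
  have e : VectorFourier.fourierIntegral 𝐞 volume (innerₗ ℝ)
      (fun x : ℝ => Complex.exp (-Real.pi * (Real.pi / b) * x ^ 2)) = _ := fourier_gaussian_pi hc
  have e2 : VectorFourier.fourierIntegral 𝐞 volume (innerₗ ℝ).flip f = 𝓕 f := by
    rw [flip_innerₗ]; rfl
  rw [e, e2] at key
  have hcp : 1 / ((Real.pi : ℂ) / b) ^ (1 / 2 : ℂ) * ((√Real.pi : ℂ) * b ^ (-(1 / 2) : ℂ)) = 1 := by
    have harg : b.arg ≠ Real.pi := by
      intro h
      have := Complex.arg_eq_pi_iff.1 h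
      linarith [this.1]
    have hs : (√Real.pi : ℂ) = (Real.pi : ℂ) ^ (1 / 2 : ℂ) := by
      rw [Real.sqrt_eq_rpow, Complex.ofReal_cpow Real.pi_nonneg]
      norm_num
    have hd : ((Real.pi : ℂ) / b) ^ (1 / 2 : ℂ) = (√Real.pi : ℂ) * b ^ (-(1 / 2) : ℂ) := by
      rw [hs, Complex.cpow_neg, ← Complex.inv_cpow _ _ harg, div_eq_mul_inv,
        Complex.cpow_def_of_ne_zero (mul_ne_zero hπ (inv_ne_zero hb0)),
        Complex.cpow_def_of_ne_zero hπ, Complex.cpow_def_of_ne_zero (inv_ne_zero hb0),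
        Complex.log_ofReal_mul Real.pi_pos (inv_ne_zero hb0), ← Complex.exp_add,
        Complex.ofReal_log Real.pi_nonneg]
      ring_nf
    rw [← hd, one_div_mul_cancel]
    rw [Complex.cpow_ne_zero_iff]
    exact Or.inl (div_ne_zero hπ hb0)
  have el : ∀ x : ℝ, 1 / ((Real.pi : ℂ) / b) ^ (1 / 2 : ℂ) *
      Complex.exp (-Real.pi / (Real.pi / b) * x ^ 2) • f x =
      1 / ((Real.pi : ℂ) / b) ^ (1 / 2 : ℂ) * (Complex.exp (-b * x ^ 2) * f x) := by
    intro x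
    rw [smul_eq_mul]
    congr 4
    field_simp
  have er : ∀ ξ : ℝ, Complex.exp (-Real.pi * (Real.pi / b) * ξ ^ 2) =
      Complex.exp (-(Real.pi ^ 2 / b) * ξ ^ 2) := fun ξ => by congr 1; ring
  simp only [smul_eq_mul, mul_assoc (1 / _ : ℂ)] at key el
  simp only [el, er, integral_const_mul] at key
  rw [← key, ← mul_assoc, mul_comm (_ * _) (1 / _), hcp, one_mul]

/-- Even moments of the Fourier transform are derivatives at the origin. -/
theorem integral_even_pow_mul_fourier (f : SchwartzMap ℝ ℂ) (j : ℕ) :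
    ∫ ξ : ℝ, (ξ : ℂ) ^ (2 * j) * 𝓕 (f : ℝ → ℂ) ξ =
      (-1) ^ j / (4 * Real.pi ^ 2) ^ j * iteratedDeriv (2 * j) f 0 := by
  have hint : ∀ n : ℕ, Integrable (iteratedDeriv n f) := fun n =>
    ((f.integrable_pow_mul_iteratedFDeriv volume 0 n).congr'
      (f.smooth'.continuous_iteratedDeriv n (by exact_mod_cast le_top)).aestronglyMeasurable
      (.of_forall fun x => by simp [norm_iteratedFDeriv_eq_norm_iteratedDeriv]))
  have hF := Real.fourier_iteratedDeriv (N := ⊤) (n := 2 * j) (f.smooth ⊤)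
    (fun n _ => hint n) le_top
  have hπ : (Real.pi : ℂ) ≠ 0 := by exact_mod_cast Real.pi_ne_zero
  have hFi : Integrable (𝓕 (iteratedDeriv (2 * j) f)) := by
    rw [hF]
    refine (((𝓕 f).integrable_pow_mul volume (2 * j)).const_mul ((2 * Real.pi) ^ (2 * j))).mono'
      ?_ (.of_forall fun x => ?_)
    · have : Continuous (𝓕 (f : ℝ → ℂ)) := (𝓕 f).continuous
      exact Continuous.aestronglyMeasurable (by fun_prop)
    · simp [mul_pow, SchwartzMap.fourier_coe, abs_of_pos Real.pi_pos, mul_assoc]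
  have hinv := congrFun (Continuous.fourierInv_fourier_eq
    ((f.smooth ⊤).continuous_iteratedDeriv (2 * j)
      (WithTop.coe_le_coe.2 le_top)) (hint _) hFi) 0
  rw [← hinv, Real.fourierInv_eq, hF]
  have e : ∀ v : ℝ, 𝐞 (inner ℝ v 0) • ((2 * Real.pi * Complex.I * v) ^ (2 * j) • 𝓕 (f : ℝ → ℂ) v) =
      ((4 * Real.pi ^ 2) ^ j * (-1) ^ j) * ((v : ℂ) ^ (2 * j) * 𝓕 (f : ℝ → ℂ) v) := by
    intro v
    simp only [inner_zero_right, AddChar.map_zero_eq_one, one_smul, smul_eq_mul, mul_pow, pow_mul,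
      Complex.I_sq]
    norm_num
    ring
  simp only [e, integral_const_mul]
  rw [← mul_assoc]
  have h1 : ((-1 : ℂ) ^ j) * (-1) ^ j = 1 := by rw [← mul_pow]; simp
  rw [show (-1 : ℂ) ^ j / (4 * Real.pi ^ 2) ^ j * ((4 * Real.pi ^ 2) ^ j * (-1) ^ j) =
    ((-1 : ℂ) ^ j) * (-1) ^ j by field_simp, h1, one_mul]

theorem integrable_pow_mul_fourier (f : SchwartzMap ℝ ℂ) (j : ℕ) :
    Integrable (fun ξ : ℝ => (ξ : ℂ) ^ j * 𝓕 (f : ℝ → ℂ) ξ) := by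
  have hc : Continuous (𝓕 (f : ℝ → ℂ)) := (𝓕 f).continuous
  refine ((𝓕 f).integrable_pow_mul volume j).mono'
    (Continuous.aestronglyMeasurable (by fun_prop)) (.of_forall fun x => ?_)
  simp [SchwartzMap.fourier_coe]

theorem cpow_neg_nat_sub_half {b : ℂ} (hb : b ≠ 0) (j : ℕ) :
    b ^ (-(j : ℂ) - 1 / 2) = b ^ (-(1 / 2) : ℂ) * (b ^ j)⁻¹ := by
  rw [show -(j : ℂ) - 1 / 2 = -(1 / 2) - (j : ℂ) by ring, Complex.cpow_sub _ _ hb,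
    Complex.cpow_natCast, div_eq_mul_inv]

/-- Laplace expansion at the origin against a complex Gaussian. -/
theorem norm_gaussian_integral_sub_expansion_le {b : ℂ} (hb : 0 < b.re) (f : SchwartzMap ℝ ℂ)
    (n : ℕ) :
    ‖(∫ x : ℝ, Complex.exp (-b * x ^ 2) * f x) - ∑ j ∈ Finset.range n,
        (√Real.pi : ℂ) / (4 ^ j * (Nat.factorial j : ℂ)) * b ^ (-(j : ℂ) - 1 / 2) *
          iteratedDeriv (2 * j) f 0‖ ≤
      √Real.pi * ‖b ^ (-(1 / 2) : ℂ)‖ * ((n + 3) * (Real.pi ^ 2 / ‖b‖) ^ n *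
        ∫ ξ : ℝ, |ξ| ^ (2 * n) * ‖𝓕 (f : ℝ → ℂ) ξ‖) := by
  have hb0 : b ≠ 0 := by rintro rfl; simp at hb
  have hπ : (Real.pi : ℂ) ≠ 0 := by exact_mod_cast Real.pi_ne_zero
  have hre : ∀ ξ : ℝ, (-((Real.pi : ℂ) ^ 2 / b) * ξ ^ 2).re ≤ 0 := by
    intro ξ
    rw [show -((Real.pi : ℂ) ^ 2 / b) * ξ ^ 2 = ((-(Real.pi ^ 2 * ξ ^ 2) : ℝ) : ℂ) * b⁻¹ by
      push_cast; ring, Complex.re_ofReal_mul, Complex.inv_re]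
    exact mul_nonpos_of_nonpos_of_nonneg (by simp; positivity)
      (div_nonneg hb.le (Complex.normSq_nonneg _))
  have hF : Integrable (𝓕 (f : ℝ → ℂ)) := (𝓕 f).integrable
  have hterm : ∀ j : ℕ, ∀ ξ : ℝ,
      (-((Real.pi : ℂ) ^ 2 / b) * ξ ^ 2) ^ j / (j.factorial : ℂ) * 𝓕 (f : ℝ → ℂ) ξ =
      ((-((Real.pi : ℂ) ^ 2 / b)) ^ j / (j.factorial : ℂ)) *
        ((ξ : ℂ) ^ (2 * j) * 𝓕 (f : ℝ → ℂ) ξ) := by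
    intro j ξ
    rw [mul_pow, ← pow_mul]
    ring
  have hsumi : ∀ j ∈ Finset.range n, Integrable (fun ξ : ℝ =>
      (-((Real.pi : ℂ) ^ 2 / b) * ξ ^ 2) ^ j / (j.factorial : ℂ) * 𝓕 (f : ℝ → ℂ) ξ) := by
    intro j _
    simp only [hterm]
    exact (integrable_pow_mul_fourier f _).const_mul _
  have hsum : ∑ j ∈ Finset.range n,
        (√Real.pi : ℂ) / (4 ^ j * (Nat.factorial j : ℂ)) * b ^ (-(j : ℂ) - 1 / 2) *
          iteratedDeriv (2 * j) f 0 = (√Real.pi : ℂ) * b ^ (-(1 / 2) : ℂ) *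
      ∫ ξ : ℝ, (∑ j ∈ Finset.range n,
        (-((Real.pi : ℂ) ^ 2 / b) * ξ ^ 2) ^ j / (j.factorial : ℂ) * 𝓕 (f : ℝ → ℂ) ξ) := by
    rw [integral_finsetSum _ hsumi, Finset.mul_sum]
    refine Finset.sum_congr rfl fun j _ => ?_
    simp only [hterm]
    rw [integral_const_mul, integral_even_pow_mul_fourier, cpow_neg_nat_sub_half hb0, neg_pow]
    have h1 : ((-1 : ℂ) ^ j) * (-1) ^ j = 1 := by rw [← mul_pow]; simp
    have h2 : (Nat.factorial j : ℂ) ≠ 0 := by exact_mod_cast Nat.factorial_ne_zero _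
    have h3 : (-1 : ℂ) ^ j * (Real.pi ^ 2 / b) ^ j / (j.factorial : ℂ) *
        ((-1) ^ j / (4 * Real.pi ^ 2) ^ j * iteratedDeriv (2 * j) f 0) =
        ((-1 : ℂ) ^ j * (-1) ^ j) * ((4 ^ j * (Nat.factorial j : ℂ))⁻¹ * (b ^ j)⁻¹ *
          iteratedDeriv (2 * j) f 0) := by
      rw [div_pow, mul_pow]
      field_simp
    rw [h3, h1]
    ring
  have hexp : Integrable (fun ξ : ℝ =>
      Complex.exp (-((Real.pi : ℂ) ^ 2 / b) * ξ ^ 2) * 𝓕 (f : ℝ → ℂ) ξ) := by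
    refine hF.norm.mono' ?_ (.of_forall fun ξ => ?_)
    · have hc : Continuous (𝓕 (f : ℝ → ℂ)) := (𝓕 f).continuous
      exact Continuous.aestronglyMeasurable (by fun_prop)
    · rw [norm_mul, Complex.norm_exp]
      exact mul_le_of_le_one_left (norm_nonneg _) (Real.exp_le_one_iff.2 (hre ξ))
  rw [hsum, integral_cexp_neg_mul_sq_mul_eq hb f.integrable, ← mul_sub,
    ← integral_sub hexp (integrable_finsetSum _ hsumi), norm_mul, norm_mul, Complex.norm_real,
    Real.norm_of_nonneg (Real.sqrt_nonneg _), ← integral_const_mul]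
  gcongr
  refine norm_integral_le_of_norm_le ?_ (.of_forall fun ξ => ?_)
  · refine Integrable.const_mul ?_ _
    exact (𝓕 f).integrable_pow_mul volume (2 * n)
  · rw [← Finset.sum_mul, ← sub_mul, norm_mul]
    refine (mul_le_mul_of_nonneg_right (norm_exp_sub_taylor_le (hre ξ) n)
      (norm_nonneg _)).trans_eq ?_
    have : ‖-((Real.pi : ℂ) ^ 2 / b) * (ξ : ℂ) ^ 2‖ = Real.pi ^ 2 / ‖b‖ * |ξ| ^ 2 := by
      simp
    rw [this, mul_pow, ← pow_mul]
    ring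

/-- Quadratic stationary phase expansion at the origin for a Schwartz function. -/
theorem norm_oscillatory_integral_sub_expansion_le {t : ℝ} (ht : 0 < t) (f : SchwartzMap ℝ ℂ)
    (n : ℕ) :
    ‖(∫ x : ℝ, Complex.exp (Complex.I * t * x ^ 2) * f x) - ∑ j ∈ Finset.range n,
        (√Real.pi : ℂ) / (4 ^ j * (Nat.factorial j : ℂ)) *
          (-Complex.I * t) ^ (-(j : ℂ) - 1 / 2) * iteratedDeriv (2 * j) f 0‖ ≤
      √Real.pi * t ^ (-(1 / 2) : ℝ) * ((n + 3) * (Real.pi ^ 2 / t) ^ n *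
        ∫ ξ : ℝ, |ξ| ^ (2 * n) * ‖𝓕 (f : ℝ → ℂ) ξ‖) := by
  have hslit : -Complex.I * t ∈ Complex.slitPlane := by
    simp [Complex.mem_slitPlane_iff, ht.ne']
  have hnorm : ‖-Complex.I * (t : ℂ)‖ = t := by simp [abs_of_pos ht]
  have hb : Tendsto (fun ε : ℝ => (ε : ℂ) + -Complex.I * t) (𝓝[>] 0) (𝓝 (-Complex.I * t)) := by
    have : Continuous (fun ε : ℝ => (ε : ℂ) + -Complex.I * t) := by fun_prop
    simpa using this.continuousWithinAt (s := Ioi 0) (x := 0) |>.tendsto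
  have hpow : ∀ c : ℂ, Tendsto (fun ε : ℝ => ((ε : ℂ) + -Complex.I * t) ^ c) (𝓝[>] 0)
      (𝓝 ((-Complex.I * t) ^ c)) := fun c =>
    (continuousAt_cpow_const hslit).tendsto.comp hb
  have hint : Tendsto (fun ε : ℝ =>
      ∫ x : ℝ, Complex.exp (-((ε : ℂ) + -Complex.I * t) * x ^ 2) * f x)
      (𝓝[>] 0) (𝓝 (∫ x : ℝ, Complex.exp (Complex.I * t * x ^ 2) * f x)) := by
    refine tendsto_integral_filter_of_dominated_convergence (fun x => ‖f x‖) ?_ ?_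
      f.integrable.norm ?_
    · exact .of_forall fun ε => Continuous.aestronglyMeasurable
        (by have := f.continuous; fun_prop)
    · filter_upwards [self_mem_nhdsWithin] with ε hε
      refine .of_forall fun x => ?_
      rw [norm_mul, Complex.norm_exp]
      refine mul_le_of_le_one_left (norm_nonneg _) (Real.exp_le_one_iff.2 ?_)
      rw [← Complex.ofReal_pow, Complex.re_mul_ofReal]
      simp only [mem_Ioi] at hε
      simp
      positivity
    · refine .of_forall fun x => Tendsto.mul_const _ ?_
      have h := (Complex.continuous_exp.tendsto _).comp (hb.neg.mul_const ((x : ℂ) ^ 2))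
      simpa [Function.comp_def] using h
  have hA : ‖(-Complex.I * (t : ℂ)) ^ (-(1 / 2) : ℂ)‖ = t ^ (-(1 / 2) : ℝ) := by
    have := Complex.norm_cpow_real (-Complex.I * (t : ℂ)) (-(1 / 2) : ℝ)
    rw [hnorm] at this
    rw [← this]
    push_cast
    rfl
  have hL := (hint.sub (tendsto_finsetSum (Finset.range n) fun j _ =>
    ((hpow (-(j : ℂ) - 1 / 2)).const_mul
      ((√Real.pi : ℂ) / (4 ^ j * (Nat.factorial j : ℂ)))).mul_const
        (iteratedDeriv (2 * j) f 0))).norm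
  have hR := ((hpow (-(1 / 2))).norm.const_mul √Real.pi).mul
    ((((tendsto_const_nhds (x := Real.pi ^ 2)).div hb.norm (by rw [hnorm]; exact ht.ne')).pow n
      |>.const_mul ((n : ℝ) + 3)).mul_const (∫ ξ : ℝ, |ξ| ^ (2 * n) * ‖𝓕 (f : ℝ → ℂ) ξ‖))
  rw [hA, hnorm] at hR
  refine le_of_tendsto_of_tendsto hL hR ?_
  filter_upwards [self_mem_nhdsWithin] with ε hε
  exact norm_gaussian_integral_sub_expansion_le (by simpa using hε) f n

theorem integral_pow_mul_norm_fourier_le (f : SchwartzMap ℝ ℂ) (n : ℕ) :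
    ∫ ξ : ℝ, |ξ| ^ n * ‖𝓕 (f : ℝ → ℂ) ξ‖ ≤
      Real.pi * (2 ^ n * ∑ p ∈ Finset.range (n + 1), (∫ x, ‖iteratedFDeriv ℝ p f x‖) +
        2 ^ (n + 2) * ∑ p ∈ Finset.range (n + 2 + 1), ∫ x, ‖iteratedFDeriv ℝ p f x‖) := by
  have hm : ∀ (m : ℕ) (ξ : ℝ), |ξ| ^ m * ‖𝓕 (f : ℝ → ℂ) ξ‖ ≤
      2 ^ m * ∑ p ∈ Finset.range (m + 1), (∫ x, ‖iteratedFDeriv ℝ p f x‖) := by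
    intro m ξ
    have := Real.pow_mul_norm_iteratedFDeriv_fourier_le (K := ⊤) (N := ⊤) (f.smooth ⊤)
      (fun k n _ _ => f.integrable_pow_mul_iteratedFDeriv volume k n) (k := 0) (n := m)
      le_top le_top ξ
    simpa [Finset.sum_product] using this
  have hi := (𝓕 f).integrable_pow_mul volume n
  rw [mul_comm, ← integral_univ_inv_one_add_sq, ← integral_const_mul]
  refine integral_mono hi (integrable_inv_one_add_sq.const_mul _) fun ξ => ?_
  simp only
  rw [← div_eq_mul_inv, le_div_iff₀ (by positivity)]
  have e : |ξ| ^ n * ‖𝓕 (f : ℝ → ℂ) ξ‖ * (1 + ξ ^ 2) =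
      |ξ| ^ n * ‖𝓕 (f : ℝ → ℂ) ξ‖ + |ξ| ^ (n + 2) * ‖𝓕 (f : ℝ → ℂ) ξ‖ := by
    rw [pow_add, sq_abs]; ring
  refine e.trans_le (add_le_add (hm n ξ) (hm (n + 2) ξ))

theorem exists_integral_norm_iteratedFDeriv_mul_translate_le (g φ : SchwartzMap ℝ ℂ) (p : ℕ) :
    ∃ K, ∀ (a : ℝ) (f : SchwartzMap ℝ ℂ), (∀ x, f x = g x * φ (a + x)) →
      ∫ x, ‖iteratedFDeriv ℝ p f x‖ ≤ K := by
  refine ⟨∫ x, ∑ i ∈ Finset.range (p + 1), (p.choose i : ℝ) * ‖iteratedFDeriv ℝ i g x‖ *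
    SchwartzMap.seminorm ℝ 0 (p - i) φ, fun a f hf => ?_⟩
  have hi : ∀ (h : SchwartzMap ℝ ℂ) i, Integrable (fun x => ‖iteratedFDeriv ℝ i h x‖) := by
    intro h i
    simpa using h.integrable_pow_mul_iteratedFDeriv volume 0 i
  refine integral_mono (hi f p)
    (integrable_finsetSum _ fun i _ => ((hi g i).const_mul _).mul_const _) fun x => ?_
  have hfe : (f : ℝ → ℂ) = fun x => g x * φ (a + x) := funext hf
  simp only [hfe]
  have hφ : ContDiff ℝ (⊤ : ℕ∞) fun x => φ (a + x) := by
    have := φ.smooth ⊤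
    fun_prop
  refine (norm_iteratedFDeriv_mul_le (g.smooth ⊤) hφ x (WithTop.coe_le_coe.2 le_top)).trans
    (Finset.sum_le_sum fun i _ => ?_)
  gcongr
  rw [iteratedFDeriv_comp_add_left]
  exact SchwartzMap.norm_iteratedFDeriv_le_seminorm ℝ φ _ _

/-- Quadratic stationary phase expansion, uniform in the translation
parameter: for `ψ ∈ C_c^∞(ℝ)` equal to `1` near `0`, `φ` Schwartz, and `N ∈ ℕ`, there is
`C > 0` such that for all `t ≥ 1` and `a ∈ ℝ`,
`|∫ e^{itδ²} ψ(δ) φ(a+δ) dδ - ∑_{j=0}^N (Γ(j+1/2)/(2j)!) (-it)^{-j-1/2} φ^{(2j)}(a)|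
  ≤ C t^{-N-1}`. -/
theorem stmt7 (ψ : ℝ → ℂ) (hψs : ContDiff ℝ (⊤ : ℕ∞) ψ) (hψc : HasCompactSupport ψ)
    (hψ1 : ∀ᶠ x in 𝓝 (0 : ℝ), ψ x = 1) (φ : SchwartzMap ℝ ℂ) (N : ℕ) :
    ∃ C > 0, ∀ t : ℝ, 1 ≤ t → ∀ a : ℝ,
      ‖(∫ δ : ℝ, Complex.exp (Complex.I * t * δ ^ 2) * ψ δ * φ (a + δ)) -
          ∑ j ∈ Finset.range (N + 1),
            (Complex.Gamma ((j : ℂ) + 1 / 2) / (Nat.factorial (2 * j) : ℂ)) *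
              (-Complex.I * t) ^ (-(j : ℂ) - 1 / 2) *
              iteratedDeriv (2 * j) (fun x : ℝ => φ x) a‖ ≤
        C / t ^ (N + 1) := by
  let g : SchwartzMap ℝ ℂ := hψc.toSchwartzMap hψs
  choose K hK using exists_integral_norm_iteratedFDeriv_mul_translate_le g φ
  set n := N + 1
  set M : ℝ := Real.pi * (2 ^ (2 * n) * ∑ p ∈ Finset.range (2 * n + 1), K p +
    2 ^ (2 * n + 2) * ∑ p ∈ Finset.range (2 * n + 2 + 1), K p) with hM
  refine ⟨max 1 (√Real.pi * ((n + 3) * (Real.pi ^ 2) ^ n * M)), by positivity, fun t ht a => ?_⟩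
  have ht0 : 0 < t := by linarith
  have hfs : ContDiff ℝ (⊤ : ℕ∞) fun x => ψ x * φ (a + x) := by
    have := φ.smooth ⊤
    fun_prop
  have hfc : HasCompactSupport fun x => ψ x * φ (a + x) := hψc.mul_right
  set f : SchwartzMap ℝ ℂ := hfc.toSchwartzMap hfs
  have hfe : ∀ x, f x = ψ x * φ (a + x) := fun _ => rfl
  have hbound : ∫ ξ : ℝ, |ξ| ^ (2 * n) * ‖𝓕 (f : ℝ → ℂ) ξ‖ ≤ M := by
    refine (integral_pow_mul_norm_fourier_le f (2 * n)).trans ?_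
    rw [hM]
    gcongr with p _ p _ <;> exact hK _ a f hfe
  have hder : ∀ j, iteratedDeriv j f 0 = iteratedDeriv j (fun x : ℝ => φ x) a := by
    intro j
    have he : (f : ℝ → ℂ) =ᶠ[𝓝 0] fun x => φ (a + x) := by
      filter_upwards [hψ1] with x hx
      rw [hfe, hx, one_mul]
    rw [he.iteratedDeriv_eq, iteratedDeriv_comp_const_add]
    simp only [add_zero]
  have key := norm_oscillatory_integral_sub_expansion_le ht0 f n
  simp only [gamma_add_half_div_factorial, mul_assoc (Complex.exp _), ← hfe, ← hder]
  refine key.trans ?_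
  have h1 : t ^ (-(1 / 2) : ℝ) ≤ 1 := Real.rpow_le_one_of_one_le_of_nonpos ht (by norm_num)
  have hI : 0 ≤ ∫ ξ : ℝ, |ξ| ^ (2 * n) * ‖𝓕 (f : ℝ → ℂ) ξ‖ :=
    integral_nonneg fun ξ => by positivity
  calc _ ≤ √Real.pi * 1 * ((n + 3) * (Real.pi ^ 2 / t) ^ n * M) := by gcongr
    _ = √Real.pi * ((n + 3) * (Real.pi ^ 2) ^ n * M) / t ^ n := by rw [div_pow]; ring
    _ ≤ _ := by gcongr; exact le_max_right _ _
end

section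
/- Let J, K ∈ ℕ, let ψ ∈ C_c^∞(ℝ), and let φ be a Schwartz function on ℝ. Then for every M ∈ ℕ there exists C > 0 such that for all t ≥ 1 and all c ≥ 1: |∫_{−∞}^{∞} e^{itΔ²} Δ^J ψ(Δ) ( ∫_0^Δ (Δ−δ)^K φ(c+δ) dδ ) dΔ| ≤ C · t^{−⌊(J+K+1)/2⌋} · c^{−M}, where ⌊·⌋ denotes the floor function and the inner integral ∫_0^Δ is oriented (equal to minus ∫_Δ^0 when Δ < 0). -/
open MeasureTheory Filter Set Topology

/-- The average `∫₀¹ p(s) f(c + s x) ds`, in terms of which Taylor remainders are expressed. -/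
noncomputable def segmentAverage (p : ℝ → ℂ) (f : SchwartzMap ℝ ℂ) (c x : ℝ) : ℂ :=
  ∫ s in (0 : ℝ)..1, p s * f (c + s * x)

lemma hasDerivAt_segmentAverage {p : ℝ → ℂ} (hp : Continuous p) (f : SchwartzMap ℝ ℂ)
    (c x : ℝ) :
    HasDerivAt (segmentAverage p f c)
      (segmentAverage (fun s => s * p s) (SchwartzMap.derivCLM ℂ ℂ f) c x) x := by
  set f' := SchwartzMap.derivCLM ℂ ℂ f
  obtain ⟨B, -, hB⟩ := f'.decay 0 0
  simp only [pow_zero, one_mul, norm_iteratedFDeriv_zero] at hB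
  refine (intervalIntegral.hasDerivAt_integral_of_dominated_loc_of_deriv_le
    (F := fun x s => p s * f (c + s * x)) (F' := fun x s => s * p s * f' (c + s * x))
    (bound := fun s => ‖(s : ℂ) * p s‖ * B) univ_mem ?_ ?_ ?_ ?_ ?_ ?_).2
  · exact Eventually.of_forall fun y => (by fun_prop : Continuous _).aestronglyMeasurable
  · exact (by fun_prop : Continuous _).intervalIntegrable _ _
  · exact (by fun_prop : Continuous _).aestronglyMeasurable
  · refine Eventually.of_forall fun s _ y _ => ?_
    rw [norm_mul]
    gcongr
    exact hB _
  · exact (by fun_prop : Continuous _).intervalIntegrable _ _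
  · refine Eventually.of_forall fun s _ y _ => ?_
    have h1 : HasDerivAt (fun y : ℝ => c + s * y) s y := by
      simpa using ((hasDerivAt_id y).const_mul s).const_add c
    have h2 : HasDerivAt f (f' (c + s * y)) (c + s * y) := by
      simpa [f'] using (f.differentiableAt (x := c + s * y)).hasDerivAt
    have h3 := (h2.scomp y h1).const_mul (p s)
    refine h3.congr_deriv ?_
    rw [Complex.real_smul]
    ring

lemma continuous_segmentAverage {p : ℝ → ℂ} (hp : Continuous p) (f : SchwartzMap ℝ ℂ) (c : ℝ) :
    Continuous (segmentAverage p f c) :=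
  continuous_iff_continuousAt.2 fun x => (hasDerivAt_segmentAverage hp f c x).continuousAt

/-- Rapid decay of a Schwartz function at `+∞` is stable under bounded translations. -/
lemma SchwartzMap.exists_norm_le_div_pow_of_dist_le (f : SchwartzMap ℝ ℂ) (M : ℕ) (R : ℝ) :
    ∃ D, 0 ≤ D ∧ ∀ c : ℝ, 1 ≤ c → ∀ y : ℝ, dist y c ≤ R → ‖f y‖ ≤ D / c ^ M := by
  obtain ⟨A, hA, hA'⟩ := f.decay M 0
  obtain ⟨B, hB, hB'⟩ := f.decay 0 0
  simp only [pow_zero, one_mul, norm_iteratedFDeriv_zero] at hA' hB'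
  refine ⟨2 ^ (M - 1) * (A + |R| ^ M * B), by positivity, fun c hc y hy => ?_⟩
  have hc' : c ≤ ‖y‖ + |R| := by
    rw [Real.dist_eq] at hy
    have h1 := neg_abs_le (y - c)
    have h2 := le_abs_self y
    have h3 := le_abs_self R
    rw [Real.norm_eq_abs]
    linarith
  rw [le_div_iff₀ (by positivity)]
  calc ‖f y‖ * c ^ M ≤ ‖f y‖ * (2 ^ (M - 1) * (‖y‖ ^ M + |R| ^ M)) := by
        gcongr
        exact (pow_le_pow_left₀ (by linarith) hc' M).trans
          (add_pow_le (norm_nonneg y) (abs_nonneg R) M)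
    _ = 2 ^ (M - 1) * (‖y‖ ^ M * ‖f y‖ + |R| ^ M * ‖f y‖) := by ring
    _ ≤ _ := by
        gcongr
        exacts [hA' y, hB' y]

lemma exists_norm_segmentAverage_le {p : ℝ → ℂ} (hp : Continuous p) (f : SchwartzMap ℝ ℂ)
    (M : ℕ) (R : ℝ) :
    ∃ D, 0 ≤ D ∧ ∀ c : ℝ, 1 ≤ c → ∀ x : ℝ, |x| ≤ R → ‖segmentAverage p f c x‖ ≤ D / c ^ M := by
  obtain ⟨D, hD, h⟩ := f.exists_norm_le_div_pow_of_dist_le M R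
  obtain ⟨P, hP⟩ := (isCompact_Icc (a := (0 : ℝ)) (b := 1)).exists_bound_of_continuousOn
    hp.continuousOn
  have hP0 : 0 ≤ P := (norm_nonneg _).trans (hP 0 (by simp))
  refine ⟨P * D, by positivity, fun c hc x hx => ?_⟩
  refine (intervalIntegral.norm_integral_le_of_norm_le_const (C := P * (D / c ^ M))
    fun s hs => ?_).trans_eq (by simp; ring)
  rw [uIoc_of_le zero_le_one] at hs
  rw [norm_mul]
  gcongr
  · exact hP s ⟨hs.1.le, hs.2⟩
  · refine h c hc _ ?_
    rw [Real.dist_eq, add_sub_cancel_left, abs_mul, abs_of_pos hs.1]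
    exact (mul_le_of_le_one_left (abs_nonneg x) hs.2).trans hx

/-- Integration by parts against the quadratic phase. -/
lemma integral_exp_sq_mul_pow_add_two {g g' : ℝ → ℂ} (hg : ∀ x, HasDerivAt g (g' x) x)
    (hg' : Continuous g') (hc : HasCompactSupport g) {t : ℝ} (ht : t ≠ 0) (N : ℕ) :
    ∫ x : ℝ, Complex.exp (Complex.I * t * x ^ 2) * (x : ℂ) ^ (N + 2) * g x =
      -(2 * Complex.I * t)⁻¹ *
        ∫ x : ℝ, Complex.exp (Complex.I * t * x ^ 2) * (x : ℂ) ^ N * ((N + 1) * g x + x * g' x) := by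
  have hgc : Continuous g := continuous_iff_continuousAt.2 fun x => (hg x).continuousAt
  have hc' : HasCompactSupport g' := by
    rw [← funext fun x => (hg x).deriv]
    exact hc.deriv
  have i1 : Integrable fun x : ℝ =>
      Complex.exp (Complex.I * t * x ^ 2) * (x : ℂ) ^ (N + 2) * g x :=
    (by fun_prop : Continuous _).integrable_of_hasCompactSupport hc.mul_left
  have i2 : Integrable fun x : ℝ =>
      Complex.exp (Complex.I * t * x ^ 2) * (x : ℂ) ^ N * ((N + 1) * g x + x * g' x) :=
    (by fun_prop : Continuous _).integrable_of_hasCompactSupport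
      (hc.mul_left.add hc'.mul_left).mul_left
  have i3 : Integrable fun x : ℝ =>
      Complex.exp (Complex.I * t * x ^ 2) * (x : ℂ) ^ (N + 1) * g x :=
    (by fun_prop : Continuous _).integrable_of_hasCompactSupport hc.mul_left
  have hd (x : ℝ) : HasDerivAt
      (fun x : ℝ => Complex.exp (Complex.I * t * x ^ 2) * (x : ℂ) ^ (N + 1) * g x)
      (2 * Complex.I * t * (Complex.exp (Complex.I * t * x ^ 2) * (x : ℂ) ^ (N + 2) * g x) +
        Complex.exp (Complex.I * t * x ^ 2) * (x : ℂ) ^ N * ((N + 1) * g x + x * g' x)) x := by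
    have hx : HasDerivAt (fun x : ℝ => (x : ℂ)) 1 x := Complex.ofRealCLM.hasDerivAt
    refine ((((hx.pow 2).const_mul (Complex.I * t)).cexp.mul (hx.pow (N + 1))).mul
      (hg x)).congr_deriv ?_
    simp
    ring
  have key := integral_eq_zero_of_hasDerivAt_of_integrable hd ((i1.const_mul _).add i2) i3
  rw [integral_add (i1.const_mul _) i2, integral_const_mul] at key
  have h0 : 2 * Complex.I * t ≠ 0 := by simp [ht]
  rw [neg_mul, ← mul_neg, eq_inv_mul_iff_mul_eq₀ h0]
  exact eq_neg_of_add_eq_zero_left key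

lemma exists_norm_integral_exp_sq_mul_segmentAverage_le_div_pow (M N : ℕ) {ψ : ℝ → ℂ}
    (hψ : Continuous ψ) (hψc : HasCompactSupport ψ) {p : ℝ → ℂ} (hp : Continuous p)
    (f : SchwartzMap ℝ ℂ) :
    ∃ C, 0 ≤ C ∧ ∀ t c : ℝ, 1 ≤ c →
      ‖∫ x : ℝ, Complex.exp (Complex.I * t * x ^ 2) * (x : ℂ) ^ N *
        (ψ x * segmentAverage p f c x)‖ ≤ C / c ^ M := by
  obtain ⟨R, hR⟩ := hψc.isCompact.isBounded.subset_closedBall 0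
  obtain ⟨D, hD, h⟩ := exists_norm_segmentAverage_le hp f M R
  have hi : Integrable fun x : ℝ => ‖(x : ℂ) ^ N * ψ x‖ :=
    ((by fun_prop : Continuous _).integrable_of_hasCompactSupport hψc.mul_left).norm
  refine ⟨(∫ x : ℝ, ‖(x : ℂ) ^ N * ψ x‖) * D, by positivity, fun t c hc => ?_⟩
  rw [mul_div_assoc, ← integral_mul_const]
  refine norm_integral_le_of_norm_le (hi.mul_const _) (Eventually.of_forall fun x => ?_)
  have he : ‖Complex.exp (Complex.I * t * x ^ 2)‖ = 1 := by
    rw [Complex.norm_exp]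
    simp [← Complex.ofReal_pow]
  rw [norm_mul, norm_mul, he, one_mul, norm_mul, ← mul_assoc, ← norm_mul]
  by_cases hx : ψ x = 0
  · simp [hx]
  · gcongr
    refine h c hc x ?_
    simpa using hR (subset_tsupport _ hx)

lemma exists_norm_integral_exp_sq_mul_segmentAverage_le (M N : ℕ) {ψ : ℝ → ℂ}
    (hψ : ContDiff ℝ (⊤ : ℕ∞) ψ) (hψc : HasCompactSupport ψ) {p : ℝ → ℂ} (hp : Continuous p)
    (f : SchwartzMap ℝ ℂ) :
    ∃ C, 0 ≤ C ∧ ∀ t : ℝ, 1 ≤ t → ∀ c : ℝ, 1 ≤ c →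
      ‖∫ x : ℝ, Complex.exp (Complex.I * t * x ^ 2) * (x : ℂ) ^ N *
        (ψ x * segmentAverage p f c x)‖ ≤ C / (t ^ (N / 2) * c ^ M) := by
  induction N using Nat.twoStepInduction generalizing ψ p f with
  | zero =>
    obtain ⟨C, hC, h⟩ :=
      exists_norm_integral_exp_sq_mul_segmentAverage_le_div_pow M 0 hψ.continuous hψc hp f
    exact ⟨C, hC, fun t _ c hc => by simpa using h t c hc⟩
  | one =>
    obtain ⟨C, hC, h⟩ :=
      exists_norm_integral_exp_sq_mul_segmentAverage_le_div_pow M 1 hψ.continuous hψc hp f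
    exact ⟨C, hC, fun t _ c hc => by simpa using h t c hc⟩
  | more N ih _ =>
    set f' := SchwartzMap.derivCLM ℂ ℂ f
    have hψ' : ContDiff ℝ (⊤ : ℕ∞) (deriv ψ) := (contDiff_infty_iff_deriv.1 hψ).2
    have hψ'c : HasCompactSupport (deriv ψ) := hψc.deriv
    have hx : ContDiff ℝ (⊤ : ℕ∞) (fun x : ℝ => (x : ℂ)) := Complex.ofRealCLM.contDiff
    have hp' : Continuous fun s : ℝ => (s : ℂ) * p s := by fun_prop
    have s1 : ContDiff ℝ (⊤ : ℕ∞) fun x : ℝ => ((N : ℂ) + 1) * ψ x + x * deriv ψ x :=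
      (contDiff_const.mul hψ).add (hx.mul hψ')
    have s2 : ContDiff ℝ (⊤ : ℕ∞) fun x : ℝ => (x : ℂ) * ψ x := hx.mul hψ
    have k1 : HasCompactSupport fun x : ℝ => ((N : ℂ) + 1) * ψ x + x * deriv ψ x :=
      hψc.mul_left.add hψ'c.mul_left
    have k2 : HasCompactSupport fun x : ℝ => (x : ℂ) * ψ x := hψc.mul_left
    obtain ⟨C₁, hC₁, h₁⟩ := ih s1 k1 hp f
    obtain ⟨C₂, hC₂, h₂⟩ := ih s2 k2 hp' f'
    refine ⟨C₁ + C₂, by positivity, fun t ht c hc => ?_⟩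
    have ht0 : 0 < t := by linarith
    have cA := continuous_segmentAverage hp f c
    have cA' := continuous_segmentAverage hp' f' c
    have cψ := hψ.continuous
    have cψ' := hψ'.continuous
    rw [integral_exp_sq_mul_pow_add_two
      (g := fun x => ψ x * segmentAverage p f c x)
      (g' := fun x => deriv ψ x * segmentAverage p f c x +
        ψ x * segmentAverage (fun s => s * p s) f' c x)
      (fun x => ((hψ.differentiable (by simp) x).hasDerivAt).mul
        (hasDerivAt_segmentAverage hp f c x))
      (by fun_prop) hψc.mul_right ht0.ne']
    have split : ∀ x : ℝ, Complex.exp (Complex.I * t * x ^ 2) * (x : ℂ) ^ N *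
        ((N + 1) * (ψ x * segmentAverage p f c x) + x * (deriv ψ x * segmentAverage p f c x +
          ψ x * segmentAverage (fun s => s * p s) f' c x)) =
        Complex.exp (Complex.I * t * x ^ 2) * (x : ℂ) ^ N *
          ((((N : ℂ) + 1) * ψ x + x * deriv ψ x) * segmentAverage p f c x) +
        Complex.exp (Complex.I * t * x ^ 2) * (x : ℂ) ^ N *
          (((x : ℂ) * ψ x) * segmentAverage (fun s => s * p s) f' c x) := fun x => by ring
    simp only [split]
    have int {θ A : ℝ → ℂ} (hθ : Continuous θ) (hθc : HasCompactSupport θ) (hA : Continuous A) :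
        Integrable fun x : ℝ => Complex.exp (Complex.I * t * x ^ 2) * (x : ℂ) ^ N * (θ x * A x) :=
      (by fun_prop : Continuous _).integrable_of_hasCompactSupport hθc.mul_right.mul_left
    rw [integral_add (int s1.continuous k1 cA) (int s2.continuous k2 cA'), norm_mul]
    have hn : ‖-(2 * Complex.I * t)⁻¹‖ ≤ t⁻¹ := by
      simp only [norm_neg, norm_inv, norm_mul, Complex.norm_I, Complex.norm_real,
        Real.norm_of_nonneg ht0.le, Complex.norm_ofNat, mul_one]
      gcongr
      linarith
    calc _ ≤ t⁻¹ * (C₁ / (t ^ (N / 2) * c ^ M) + C₂ / (t ^ (N / 2) * c ^ M)) := by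
          gcongr
          exact (norm_add_le _ _).trans (add_le_add (h₁ t ht c hc) (h₂ t ht c hc))
      _ = _ := by
          rw [Nat.add_div_right N two_pos, pow_succ]
          field_simp

/-- The integral form of a Taylor remainder, rescaled to the unit interval. -/
lemma integral_sub_pow_mul_eq_pow_mul_segmentAverage (K : ℕ) (f : SchwartzMap ℝ ℂ) (c x : ℝ) :
    ∫ δ in (0 : ℝ)..x, ((x : ℂ) - (δ : ℂ)) ^ K * f (c + δ) =
      (x : ℂ) ^ (K + 1) * segmentAverage (fun s => (1 - (s : ℂ)) ^ K) f c x := by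
  have h := intervalIntegral.smul_integral_comp_mul_left (a := 0) (b := 1)
    (fun δ : ℝ => ((x : ℂ) - (δ : ℂ)) ^ K * f (c + δ)) x
  rw [mul_zero, mul_one] at h
  rw [← h, Complex.real_smul, pow_succ', mul_assoc]
  congr 1
  rw [segmentAverage, ← intervalIntegral.integral_const_mul]
  refine intervalIntegral.integral_congr fun s _ => ?_
  simp only [Complex.ofReal_mul]
  rw [mul_comm s x, ← mul_assoc, ← mul_pow, mul_sub, mul_one]


/-- Taylor-remainder oscillatory integral estimate: for `J, K ∈ ℕ`,
`ψ ∈ C_c^∞(ℝ)`, `φ` Schwartz, and every `M ∈ ℕ`, there is `C > 0` such that for all `t ≥ 1`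
and `c ≥ 1`:
`|∫ e^{itΔ²} Δ^J ψ(Δ) (∫_0^Δ (Δ-δ)^K φ(c+δ) dδ) dΔ| ≤ C t^{-⌊(J+K+1)/2⌋} c^{-M}`. -/
theorem stmt8 (J K : ℕ) (ψ : ℝ → ℂ) (hψs : ContDiff ℝ (⊤ : ℕ∞) ψ) (hψc : HasCompactSupport ψ)
    (φ : SchwartzMap ℝ ℂ) (M : ℕ) :
    ∃ C > 0, ∀ t : ℝ, 1 ≤ t → ∀ c : ℝ, 1 ≤ c →
      ‖∫ Δ : ℝ,
          Complex.exp (Complex.I * t * Δ ^ 2) * (Δ : ℂ) ^ J * ψ Δ *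
            ∫ δ in (0 : ℝ)..Δ, ((Δ : ℂ) - (δ : ℂ)) ^ K * φ (c + δ)‖ ≤
        C / (t ^ ((J + K + 1) / 2) * c ^ M) := by
  obtain ⟨C, hC, h⟩ := exists_norm_integral_exp_sq_mul_segmentAverage_le M (J + K + 1) hψs hψc
    (p := fun s : ℝ => (1 - (s : ℂ)) ^ K) (by fun_prop) φ
  refine ⟨C + 1, by positivity, fun t ht c hc => ?_⟩
  have ht0 : 0 < t := by linarith
  refine le_trans (le_of_eq ?_) ((h t ht c hc).trans ?_)
  · congr 2 with x
    rw [integral_sub_pow_mul_eq_pow_mul_segmentAverage]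
    ring
  · gcongr
    linarith
end

section
/- Let J ∈ ℕ, let ψ ∈ C_c^∞(ℝ), and let φ be a Schwartz function on ℝ. Then for every M ∈ ℕ there exists C > 0 such that for all t ≥ 1 and all c ≥ 1: |∫_{−∞}^{∞} e^{itΔ²} Δ^J ψ(Δ) φ(c+Δ) dΔ| ≤ C · t^{−⌊J/2⌋} · c^{−M}, where ⌊·⌋ denotes the floor function. -/
open MeasureTheory Filter Set Topology

/-- The integrand `e^{itΔ²} Δ^J ψ(Δ) φ(c+Δ)`. -/
noncomputable def quadPhaseIntegrand (J : ℕ) (ψ φ : ℝ → ℂ) (t c Δ : ℝ) : ℂ :=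
  Complex.exp (Complex.I * t * Δ ^ 2) * (Δ : ℂ) ^ J * ψ Δ * φ (c + Δ)

lemma integrable_quadPhaseIntegrand (J : ℕ) {ψ φ : ℝ → ℂ} (hψ : Continuous ψ)
    (hψc : HasCompactSupport ψ) (hφ : Continuous φ) (t c : ℝ) :
    Integrable (quadPhaseIntegrand J ψ φ t c) := by
  apply Continuous.integrable_of_hasCompactSupport
  · unfold quadPhaseIntegrand
    fun_prop
  · exact HasCompactSupport.mul_right <| hψc.mul_left
      (f := fun Δ : ℝ ↦ Complex.exp (Complex.I * t * Δ ^ 2) * (Δ : ℂ) ^ J)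

/-- Integration by parts against the phase `e^{itΔ²}`. -/
lemma integral_quadPhaseIntegrand_add_two (J : ℕ) {ψ : ℝ → ℂ}
    (hψs : ContDiff ℝ (⊤ : ℕ∞) ψ) (hψc : HasCompactSupport ψ) (φ : SchwartzMap ℝ ℂ) (t c : ℝ) :
    2 * Complex.I * t * ∫ Δ, quadPhaseIntegrand (J + 2) ψ φ t c Δ =
      -((J + 1) * (∫ Δ, quadPhaseIntegrand J ψ φ t c Δ) +
        (∫ Δ, quadPhaseIntegrand J (fun x ↦ x * deriv ψ x) φ t c Δ) +
        ∫ Δ, quadPhaseIntegrand J (fun x ↦ x * ψ x) (SchwartzMap.derivCLM ℂ ℂ φ) t c Δ) := by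
  have hψ := hψs.continuous
  have hψ' : Continuous (deriv ψ) := hψs.continuous_deriv (by simp)
  have i₀ := (integrable_quadPhaseIntegrand (J + 2) hψ hψc φ.continuous t c).const_mul
    (2 * Complex.I * t)
  have i₁ := (integrable_quadPhaseIntegrand J hψ hψc φ.continuous t c).const_mul (J + 1 : ℂ)
  have i₂ := integrable_quadPhaseIntegrand J (ψ := fun x ↦ x * deriv ψ x) (by fun_prop)
    hψc.deriv.mul_left φ.continuous t c
  have i₃ := integrable_quadPhaseIntegrand J (ψ := fun x ↦ x * ψ x) (by fun_prop)
    hψc.mul_left (SchwartzMap.derivCLM ℂ ℂ φ).continuous t c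
  have key := integral_eq_zero_of_hasDerivAt_of_integrable
    (f := quadPhaseIntegrand (J + 1) ψ φ t c) (fun Δ ↦ ?_) (((i₀.add i₁).add i₂).add i₃)
    (integrable_quadPhaseIntegrand (J + 1) hψ hψc φ.continuous t c)
  · rw [integral_add' ((i₀.add i₁).add i₂) i₃, integral_add' (i₀.add i₁) i₂,
      integral_add' i₀ i₁, integral_const_mul, integral_const_mul] at key
    linear_combination key
  · have hx : HasDerivAt (fun x : ℝ ↦ (x : ℂ)) 1 Δ := Complex.ofRealCLM.hasDerivAt
    have he := ((hx.pow 2).const_mul (Complex.I * t)).cexp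
    have hψd := (hψs.differentiable (by simp) Δ).hasDerivAt
    have hφd := (φ.differentiableAt (x := c + Δ)).hasDerivAt.comp_const_add c Δ
    refine (((he.mul (hx.pow (J + 1))).mul hψd).mul hφd).congr_deriv ?_
    simp only [Pi.add_apply, Pi.mul_apply, Pi.pow_apply, quadPhaseIntegrand,
      SchwartzMap.derivCLM_apply]
    push_cast
    ring

lemma exists_norm_integral_quadPhaseIntegrand_le (J : ℕ) {ψ : ℝ → ℂ} (hψ : Continuous ψ)
    (hψc : HasCompactSupport ψ) (φ : SchwartzMap ℝ ℂ) (M : ℕ) :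
    ∃ C > 0, ∀ t c : ℝ, 1 ≤ c → ‖∫ Δ, quadPhaseIntegrand J ψ φ t c Δ‖ ≤ C / c ^ M := by
  obtain ⟨A, hA⟩ : ∃ A : ℝ, ∀ x, (1 + ‖x‖) ^ M * ‖φ x‖ ≤ A :=
    ⟨_, fun x ↦ by
      simpa only [norm_iteratedFDeriv_zero] using
        SchwartzMap.one_add_le_sup_seminorm_apply (𝕜 := ℂ) (m := (M, 0)) le_rfl le_rfl φ x⟩
  set g : ℝ → ℝ := fun Δ ↦ A * (1 + ‖Δ‖) ^ M * ‖Δ‖ ^ J * ‖ψ Δ‖ with hg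
  have hgi : Integrable g :=
    (by fun_prop : Continuous g).integrable_of_hasCompactSupport hψc.norm.mul_left
  refine ⟨|∫ Δ, g Δ| + 1, by positivity, fun t c hc ↦ ?_⟩
  have hc0 : 0 < c := by linarith
  have bound : ∀ Δ, ‖quadPhaseIntegrand J ψ φ t c Δ‖ ≤ g Δ / c ^ M := fun Δ ↦ by
    have hcΔ : c ≤ (1 + ‖c + Δ‖) * (1 + ‖Δ‖) := by
      have h₁ := le_abs_self (c + Δ)
      have h₂ := neg_abs_le Δ
      simp only [Real.norm_eq_abs]
      nlinarith [mul_nonneg (abs_nonneg (c + Δ)) (abs_nonneg Δ)]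
    have hφ : c ^ M * ‖φ (c + Δ)‖ ≤ A * (1 + ‖Δ‖) ^ M := by
      calc c ^ M * ‖φ (c + Δ)‖
          ≤ ((1 + ‖c + Δ‖) * (1 + ‖Δ‖)) ^ M * ‖φ (c + Δ)‖ := by gcongr
        _ = (1 + ‖c + Δ‖) ^ M * ‖φ (c + Δ)‖ * (1 + ‖Δ‖) ^ M := by
          rw [mul_pow]
          ring
        _ ≤ A * (1 + ‖Δ‖) ^ M := by gcongr; exact hA _
    have he : ‖Complex.exp (Complex.I * t * Δ ^ 2)‖ = 1 := by
      rw [← Complex.norm_exp_ofReal_mul_I (t * Δ ^ 2)]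
      push_cast
      ring_nf
    rw [le_div_iff₀ (by positivity)]
    simp only [quadPhaseIntegrand, norm_mul, norm_pow, he, Complex.norm_real, one_mul, hg]
    calc ‖Δ‖ ^ J * ‖ψ Δ‖ * ‖φ (c + Δ)‖ * c ^ M
        = (c ^ M * ‖φ (c + Δ)‖) * (‖Δ‖ ^ J * ‖ψ Δ‖) := by ring
      _ ≤ (A * (1 + ‖Δ‖) ^ M) * (‖Δ‖ ^ J * ‖ψ Δ‖) := by gcongr
      _ = _ := by ring
  calc ‖∫ Δ, quadPhaseIntegrand J ψ φ t c Δ‖ ≤ ∫ Δ, g Δ / c ^ M :=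
        norm_integral_le_of_norm_le (hgi.div_const _) (.of_forall bound)
    _ = (∫ Δ, g Δ) / c ^ M := integral_div _ _
    _ ≤ (|∫ Δ, g Δ| + 1) / c ^ M := by
        gcongr
        linarith [le_abs_self (∫ Δ, g Δ)]

/-- For `J ∈ ℕ`, `ψ ∈ C_c^∞(ℝ)`, `φ` Schwartz, and every `M ∈ ℕ`, there is
`C > 0` such that for all `t ≥ 1` and `c ≥ 1`:
`|∫ e^{itΔ²} Δ^J ψ(Δ) φ(c+Δ) dΔ| ≤ C t^{-⌊J/2⌋} c^{-M}`. -/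
theorem stmt9 (J : ℕ) (ψ : ℝ → ℂ) (hψs : ContDiff ℝ (⊤ : ℕ∞) ψ) (hψc : HasCompactSupport ψ)
    (φ : SchwartzMap ℝ ℂ) (M : ℕ) :
    ∃ C > 0, ∀ t : ℝ, 1 ≤ t → ∀ c : ℝ, 1 ≤ c →
      ‖∫ Δ : ℝ, Complex.exp (Complex.I * t * Δ ^ 2) * (Δ : ℂ) ^ J * ψ Δ * φ (c + Δ)‖ ≤
        C / (t ^ (J / 2) * c ^ M) := by
  change ∃ C > 0, ∀ t : ℝ, 1 ≤ t → ∀ c : ℝ, 1 ≤ c →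
    ‖∫ Δ, quadPhaseIntegrand J ψ φ t c Δ‖ ≤ C / (t ^ (J / 2) * c ^ M)
  induction J using Nat.twoStepInduction generalizing ψ φ with
  | zero =>
    obtain ⟨C, hC, h⟩ := exists_norm_integral_quadPhaseIntegrand_le 0 hψs.continuous hψc φ M
    exact ⟨C, hC, fun t _ c hc ↦ by simpa using h t c hc⟩
  | one =>
    obtain ⟨C, hC, h⟩ := exists_norm_integral_quadPhaseIntegrand_le 1 hψs.continuous hψc φ M
    exact ⟨C, hC, fun t _ c hc ↦ by simpa using h t c hc⟩
  | more J ih _ =>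
    have hofReal : ContDiff ℝ (⊤ : ℕ∞) (fun x : ℝ ↦ (x : ℂ)) := Complex.ofRealCLM.contDiff
    have hψs₁ : ContDiff ℝ (⊤ : ℕ∞) (deriv ψ) := (contDiff_infty_iff_deriv.1 hψs).2
    obtain ⟨C₁, hC₁, h₁⟩ := ih ψ hψs hψc φ
    obtain ⟨C₂, hC₂, h₂⟩ := ih (fun x ↦ x * deriv ψ x) (hofReal.mul hψs₁) hψc.deriv.mul_left φ
    obtain ⟨C₃, hC₃, h₃⟩ := ih (fun x ↦ x * ψ x) (hofReal.mul hψs) hψc.mul_left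
      (SchwartzMap.derivCLM ℂ ℂ φ)
    refine ⟨(J + 1) * C₁ + C₂ + C₃, by positivity, fun t ht c hc ↦ ?_⟩
    have ht0 : 0 < t := by linarith
    have hc0 : 0 < c := by linarith
    have key := congrArg norm (integral_quadPhaseIntegrand_add_two J hψs hψc φ t c)
    have hJ : ‖(J + 1 : ℂ)‖ = J + 1 := by exact_mod_cast Complex.norm_natCast (J + 1)
    rw [norm_neg, norm_mul, norm_mul, norm_mul, Complex.norm_I, Complex.norm_real,
      Real.norm_of_nonneg ht0.le, Complex.norm_ofNat, mul_one] at key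
    have hsum := norm_add₃_le (a := (J + 1 : ℂ) * ∫ Δ, quadPhaseIntegrand J ψ φ t c Δ)
      (b := ∫ Δ, quadPhaseIntegrand J (fun x ↦ x * deriv ψ x) φ t c Δ)
      (c := ∫ Δ, quadPhaseIntegrand J (fun x ↦ x * ψ x) (SchwartzMap.derivCLM ℂ ℂ φ) t c Δ)
    rw [← key, norm_mul, hJ] at hsum
    have hle : t * ‖∫ Δ, quadPhaseIntegrand (J + 2) ψ φ t c Δ‖ ≤
        ((J + 1) * C₁ + C₂ + C₃) / (t ^ (J / 2) * c ^ M) := by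
      calc _ ≤ 2 * t * ‖∫ Δ, quadPhaseIntegrand (J + 2) ψ φ t c Δ‖ := by
            gcongr
            linarith
        _ ≤ (J + 1) * (C₁ / (t ^ (J / 2) * c ^ M)) + C₂ / (t ^ (J / 2) * c ^ M) +
            C₃ / (t ^ (J / 2) * c ^ M) := by
            refine hsum.trans ?_
            gcongr
            exacts [h₁ t ht c hc, h₂ t ht c hc, h₃ t ht c hc]
        _ = _ := by ring
    rw [Nat.add_div_right J two_pos, pow_succ]
    rw [le_div_iff₀ (by positivity)] at hle ⊢
    linarith
end

section
/- Let σ₀ > 0 and let φ be a Schwartz function on ℝ vanishing identically on (−∞, σ₀]. Then for every K ∈ ℕ there exists C > 0 such that for all t ≥ 0 and all r ≥ 0: |∫_0^∞ e^{i(σ²t + σr)} φ(σ) dσ| ≤ C (1 + t + r)^{−K}. -/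
open MeasureTheory Filter Set Topology

/-- The oscillatory integrand `e^{i(σ²t + σr)} · t^j / (2σt + r)^m · f σ`. -/
noncomputable def phaseIntegrand (t r : ℝ) (j m : ℕ) (f : ℝ → ℂ) (σ : ℝ) : ℂ :=
  Complex.exp (Complex.I * (σ ^ 2 * t + σ * r)) *
    ((t : ℂ) ^ j / ((2 * σ * t + r : ℝ) : ℂ) ^ m) * f σ

lemma norm_exp_quadratic_phase (t r σ : ℝ) :
    ‖Complex.exp (Complex.I * (σ ^ 2 * t + σ * r))‖ = 1 := by
  have h : Complex.I * ((σ : ℂ) ^ 2 * t + σ * r) = ((σ ^ 2 * t + σ * r : ℝ) : ℂ) * Complex.I := by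
    push_cast; ring
  rw [h, Complex.norm_exp_ofReal_mul_I]

lemma min_mul_add_le_phase_deriv {σ₀ t r σ : ℝ} (ht : 0 ≤ t) (hr : 0 ≤ r) (hσ : σ₀ ≤ σ) :
    min (2 * σ₀) 1 * (t + r) ≤ 2 * σ * t + r := by
  nlinarith [mul_le_mul_of_nonneg_right (min_le_left (2 * σ₀) 1) ht,
    mul_le_mul_of_nonneg_right (min_le_right (2 * σ₀) 1) hr, mul_le_mul_of_nonneg_right hσ ht]

lemma phase_deriv_pos {σ₀ t r σ : ℝ} (hσ₀ : 0 < σ₀) (ht : 0 ≤ t) (hr : 0 ≤ r) (htr : 0 < t + r)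
    (hσ : σ₀ ≤ σ) : 0 < 2 * σ * t + r :=
  (mul_pos (lt_min (by positivity) one_pos) htr).trans_le (min_mul_add_le_phase_deriv ht hr hσ)

lemma norm_phaseIntegrand_le {σ₀ t r σ : ℝ} (hσ₀ : 0 < σ₀) (ht : 0 ≤ t) (hr : 0 ≤ r)
    (htr : 0 < t + r) (hσ : σ₀ ≤ σ) (j k : ℕ) (f : ℝ → ℂ) :
    ‖phaseIntegrand t r j (j + k) f σ‖ ≤
      1 / min (2 * σ₀) 1 ^ (j + k) / (t + r) ^ k * ‖f σ‖ := by
  have hc : 0 < min (2 * σ₀) 1 := lt_min (by positivity) one_pos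
  have hD := phase_deriv_pos hσ₀ ht hr htr hσ
  rw [phaseIntegrand, norm_mul, norm_mul, norm_exp_quadratic_phase, one_mul, norm_div, norm_pow,
    norm_pow, Complex.norm_real, Complex.norm_real, Real.norm_of_nonneg ht,
    Real.norm_of_nonneg hD.le]
  refine mul_le_mul_of_nonneg_right ?_ (norm_nonneg _)
  calc t ^ j / (2 * σ * t + r) ^ (j + k)
      ≤ (t + r) ^ j / (min (2 * σ₀) 1 * (t + r)) ^ (j + k) := by
        gcongr
        · linarith
        · exact min_mul_add_le_phase_deriv ht hr hσ
    _ = 1 / min (2 * σ₀) 1 ^ (j + k) / (t + r) ^ k := by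
        rw [mul_pow, pow_add (t + r)]
        field_simp

lemma hasDerivAt_phaseIntegrand {t r σ : ℝ} (hD : 2 * σ * t + r ≠ 0) (j m : ℕ) {f : ℝ → ℂ}
    {f' : ℂ} (hf : HasDerivAt f f' σ) :
    HasDerivAt (phaseIntegrand t r j (m + 1) f)
      (Complex.I * phaseIntegrand t r j m f σ
        - 2 * (m + 1) * phaseIntegrand t r (j + 1) (m + 2) f σ
        + phaseIntegrand t r j (m + 1) (fun _ ↦ f') σ) σ := by
  have hD' : ((2 * σ * t + r : ℝ) : ℂ) ≠ 0 := by exact_mod_cast hD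
  have hid : HasDerivAt (fun x : ℝ ↦ (x : ℂ)) 1 σ := Complex.ofRealCLM.hasDerivAt
  have hE : HasDerivAt (fun x : ℝ ↦ Complex.exp (Complex.I * (x ^ 2 * t + x * r)))
      (Complex.exp (Complex.I * (σ ^ 2 * t + σ * r)) * (Complex.I * (2 * σ * t + r))) σ := by
    refine HasDerivAt.cexp ?_
    refine ((((hid.fun_pow 2).mul_const (t : ℂ)).fun_add
      (hid.mul_const (r : ℂ))).const_mul Complex.I).congr_deriv ?_
    simp
  have hd : HasDerivAt (fun x : ℝ ↦ ((2 * x * t + r : ℝ) : ℂ)) (2 * t) σ := by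
    push_cast
    refine (((hid.const_mul 2).mul_const (t : ℂ)).add_const (r : ℂ)).congr_deriv ?_
    rw [mul_one]
  have hw := (hasDerivAt_const σ ((t : ℂ) ^ j)).fun_div (hd.fun_pow (m + 1)) (pow_ne_zero _ hD')
  refine ((hE.fun_mul hw).fun_mul hf).congr_deriv ?_
  have hDe : Complex.I * phaseIntegrand t r j m f σ =
      Complex.exp (Complex.I * (σ ^ 2 * t + σ * r)) * (Complex.I * (2 * σ * t + r)) *
        ((t : ℂ) ^ j / ((2 * σ * t + r : ℝ) : ℂ) ^ (m + 1)) * f σ := by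
    rw [phaseIntegrand, show Complex.I * (2 * σ * t + r : ℂ) =
      Complex.I * ((2 * σ * t + r : ℝ) : ℂ) by push_cast; ring]
    field_simp
    ring
  rw [hDe]
  simp only [phaseIntegrand]
  generalize ((2 * σ * t + r : ℝ) : ℂ) = d at hD'
  push_cast
  field_simp
  ring

lemma integrableOn_phaseIntegrand {σ₀ t r : ℝ} (hσ₀ : 0 < σ₀) (ht : 0 ≤ t) (hr : 0 ≤ r)
    (htr : 0 < t + r) (j k : ℕ) (f : SchwartzMap ℝ ℂ) :
    IntegrableOn (phaseIntegrand t r j (j + k) f) (Ioi σ₀) := by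
  refine Integrable.mono'
    (f.integrable.norm.const_mul (1 / min (2 * σ₀) 1 ^ (j + k) / (t + r) ^ k)).integrableOn ?_ ?_
  · refine ContinuousOn.aestronglyMeasurable ?_ measurableSet_Ioi
    unfold phaseIntegrand
    refine ContinuousOn.mul (ContinuousOn.mul (by fun_prop) ?_) f.continuous.continuousOn
    refine ContinuousOn.div (by fun_prop) (by fun_prop) fun σ hσ ↦ pow_ne_zero _ ?_
    exact_mod_cast (phase_deriv_pos hσ₀ ht hr htr (le_of_lt hσ)).ne'
  · exact (ae_restrict_mem measurableSet_Ioi).mono fun σ hσ ↦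
      norm_phaseIntegrand_le hσ₀ ht hr htr (le_of_lt hσ) j k f

/-- Integration by parts against the phase `σ²t + σr`. -/
lemma integral_phaseIntegrand_eq {σ₀ t r : ℝ} (hσ₀ : 0 < σ₀) (ht : 0 ≤ t) (hr : 0 ≤ r)
    (htr : 0 < t + r) (j k : ℕ) (f : SchwartzMap ℝ ℂ) (hf : f σ₀ = 0) :
    ∫ σ in Ioi σ₀, phaseIntegrand t r j (j + k) f σ =
      Complex.I * ((∫ σ in Ioi σ₀,
          phaseIntegrand t r j (j + (k + 1)) (SchwartzMap.derivCLM ℂ ℂ f) σ)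
        - 2 * ((j + k : ℕ) + 1) *
          ∫ σ in Ioi σ₀, phaseIntegrand t r (j + 1) (j + 1 + (k + 1)) f σ) := by
  have h₁ := integrableOn_phaseIntegrand hσ₀ ht hr htr j k f
  have h₂ := integrableOn_phaseIntegrand hσ₀ ht hr htr (j + 1) (k + 1) f
  have h₃ := integrableOn_phaseIntegrand hσ₀ ht hr htr j (k + 1) (SchwartzMap.derivCLM ℂ ℂ f)
  have hlim : Tendsto (phaseIntegrand t r j (j + (k + 1)) f) atTop (𝓝 0) := by
    refine squeeze_zero_norm' ((eventually_ge_atTop σ₀).mono fun σ hσ ↦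
      norm_phaseIntegrand_le hσ₀ ht hr htr hσ j (k + 1) f) ?_
    have hf0 : Tendsto f atTop (𝓝 0) :=
      (zero_at_infty f.toZeroAtInfty).mono_left atTop_le_cocompact
    simpa using hf0.norm.const_mul (1 / min (2 * σ₀) 1 ^ (j + (k + 1)) / (t + r) ^ (k + 1))
  have hint : IntegrableOn (fun σ ↦ Complex.I * phaseIntegrand t r j (j + k) f σ
        - 2 * ((j + k : ℕ) + 1) * phaseIntegrand t r (j + 1) (j + 1 + (k + 1)) f σ
        + phaseIntegrand t r j (j + (k + 1)) (SchwartzMap.derivCLM ℂ ℂ f) σ) (Ioi σ₀) :=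
    ((h₁.const_mul _).sub (h₂.const_mul _)).add h₃
  have key := integral_Ioi_of_hasDerivAt_of_tendsto' (fun σ hσ ↦ ?_) hint hlim
  · rw [integral_add (by exact (h₁.const_mul _).sub (h₂.const_mul _)) h₃,
      integral_sub (h₁.const_mul _) (h₂.const_mul _), integral_const_mul, integral_const_mul,
      show phaseIntegrand t r j (j + (k + 1)) f σ₀ = 0 by simp [phaseIntegrand, hf]] at key
    linear_combination (-Complex.I) * key + (∫ σ in Ioi σ₀, phaseIntegrand t r j (j + k) f σ) *
      Complex.I_sq
  · have := hasDerivAt_phaseIntegrand (phase_deriv_pos hσ₀ ht hr htr hσ).ne' j (j + k)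
      (f.differentiableAt (x := σ)).hasDerivAt
    rw [show j + 1 + (k + 1) = j + k + 2 by ring]
    exact this

lemma SchwartzMap.derivCLM_eq_zero_of_eqOn_Iic {a : ℝ} {f : SchwartzMap ℝ ℂ}
    (hf : ∀ x ≤ a, f x = 0) : ∀ x ≤ a, SchwartzMap.derivCLM ℂ ℂ f x = 0 := by
  intro x hx
  rw [SchwartzMap.derivCLM_apply]
  have h₁ : HasDerivWithinAt f (deriv f x) (Iic a) x :=
    (f.differentiableAt (x := x)).hasDerivAt.hasDerivWithinAt
  have h₂ : HasDerivWithinAt f 0 (Iic a) x :=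
    (hasDerivWithinAt_const x (Iic a) (0 : ℂ)).congr hf (hf x hx)
  exact (uniqueDiffOn_Iic a x hx).eq_deriv _ h₁ h₂

lemma exists_norm_integral_phaseIntegrand_le {σ₀ : ℝ} (hσ₀ : 0 < σ₀) (n : ℕ) :
    ∀ (j k : ℕ) (f : SchwartzMap ℝ ℂ), (∀ σ ≤ σ₀, f σ = 0) →
      ∃ C, 0 ≤ C ∧ ∀ t, 0 ≤ t → ∀ r, 0 ≤ r → 0 < t + r →
        ‖∫ σ in Ioi σ₀, phaseIntegrand t r j (j + k) f σ‖ ≤ C / (t + r) ^ (k + n) := by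
  induction n with
  | zero =>
    intro j k f _
    have hc : 0 < min (2 * σ₀) 1 := lt_min (by positivity) one_pos
    refine ⟨1 / min (2 * σ₀) 1 ^ (j + k) * ∫ σ in Ioi σ₀, ‖f σ‖, by positivity,
      fun t ht r hr htr ↦ ?_⟩
    refine (norm_integral_le_of_norm_le
      (f.integrable.norm.const_mul (1 / min (2 * σ₀) 1 ^ (j + k) / (t + r) ^ k)).integrableOn
      ((ae_restrict_mem measurableSet_Ioi).mono fun σ hσ ↦
        norm_phaseIntegrand_le hσ₀ ht hr htr (le_of_lt hσ) j k f)).trans_eq ?_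
    rw [integral_const_mul, add_zero]
    ring
  | succ n ih =>
    intro j k f hf
    obtain ⟨C₁, hC₁, h₁⟩ := ih j (k + 1) (SchwartzMap.derivCLM ℂ ℂ f)
      (SchwartzMap.derivCLM_eq_zero_of_eqOn_Iic hf)
    obtain ⟨C₂, hC₂, h₂⟩ := ih (j + 1) (k + 1) f hf
    refine ⟨C₁ + 2 * ((j + k : ℕ) + 1) * C₂, by positivity, fun t ht r hr htr ↦ ?_⟩
    rw [integral_phaseIntegrand_eq hσ₀ ht hr htr j k f (hf σ₀ le_rfl), norm_mul, Complex.norm_I,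
      one_mul, add_div, mul_div_assoc, show k + (n + 1) = k + 1 + n by ring]
    refine (norm_sub_le _ _).trans (add_le_add (h₁ t ht r hr htr) ?_)
    have hnorm : ‖(2 * ((j + k : ℕ) + 1) : ℂ)‖ = 2 * ((j + k : ℕ) + 1) := by
      exact_mod_cast Complex.norm_natCast (2 * (j + k + 1))
    rw [norm_mul, hnorm]
    gcongr
    exact h₂ t ht r hr htr

/-- Let `σ₀ > 0` and let `φ` be a Schwartz function vanishing identically on
`(-∞, σ₀]`. For every `K ∈ ℕ` there is `C > 0` such that for all `t ≥ 0` and `r ≥ 0`: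
`|∫_0^∞ e^{i(σ²t + σr)} φ(σ) dσ| ≤ C (1+t+r)^{-K}`. -/
theorem stmt10 (σ₀ : ℝ) (hσ₀ : 0 < σ₀) (φ : SchwartzMap ℝ ℂ)
    (hvan : ∀ σ : ℝ, σ ≤ σ₀ → φ σ = 0) (K : ℕ) :
    ∃ C > 0, ∀ t : ℝ, 0 ≤ t → ∀ r : ℝ, 0 ≤ r →
      ‖∫ σ in Ioi (0 : ℝ), Complex.exp (Complex.I * (σ ^ 2 * t + σ * r)) * φ σ‖ ≤
        C / (1 + t + r) ^ K := by
  obtain ⟨C, hC, h⟩ := exists_norm_integral_phaseIntegrand_le hσ₀ K 0 0 φ hvan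
  have hI : 0 ≤ ∫ σ in Ioi (0 : ℝ), ‖φ σ‖ := by positivity
  refine ⟨(C + (∫ σ in Ioi (0 : ℝ), ‖φ σ‖) + 1) * 2 ^ K, by positivity, fun t ht r hr ↦ ?_⟩
  rw [le_div_iff₀ (by positivity)]
  rcases le_total (t + r) 1 with htr | htr
  · have hbound : ‖∫ σ in Ioi (0 : ℝ), Complex.exp (Complex.I * (σ ^ 2 * t + σ * r)) * φ σ‖ ≤
        ∫ σ in Ioi (0 : ℝ), ‖φ σ‖ :=
      norm_integral_le_of_norm_le φ.integrable.norm.integrableOn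
        (Eventually.of_forall fun σ ↦ by rw [norm_mul, norm_exp_quadratic_phase, one_mul])
    gcongr
    · linarith
    · linarith
  · have hsub : ∫ σ in Ioi (0 : ℝ), Complex.exp (Complex.I * (σ ^ 2 * t + σ * r)) * φ σ =
        ∫ σ in Ioi σ₀, phaseIntegrand t r 0 (0 + 0) φ σ := by
      simp only [phaseIntegrand, add_zero, pow_zero, div_one, mul_one]
      refine setIntegral_eq_of_subset_of_forall_sdiff_eq_zero measurableSet_Ioi
        (Ioi_subset_Ioi hσ₀.le) fun σ hσ ↦ ?_
      rw [hvan σ (not_lt.mp hσ.2), mul_zero]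
    have hpos : 0 < t + r := by linarith
    rw [hsub]
    calc _ ≤ C / (t + r) ^ (0 + K) * (2 * (t + r)) ^ K := by
          gcongr
          · exact h t ht r hr hpos
          · linarith
      _ = C * 2 ^ K := by rw [mul_pow, zero_add]; field_simp
      _ ≤ _ := by gcongr; linarith
end

section
/- Let ψ ∈ C_c^∞(ℝ) and let φ be a Schwartz function on ℝ. Then for every K ∈ ℕ and every r₀ > 0 there exists C > 0 such that for all t ∈ (0, 1] and all r ≥ r₀: |∫_0^∞ e^{i(σ²t − σr)} ψ(σ − r/(2t)) φ(σ) dσ| ≤ C · ⟨r⟩^{−K} · t^{K}. -/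
open MeasureTheory Filter Set Topology

/-- A Schwartz function decays faster than any power of `1 + ‖x‖`. -/
lemma SchwartzMap.exists_one_add_norm_pow_mul_norm_le {E F : Type*} [NormedAddCommGroup E]
    [NormedSpace ℝ E] [NormedAddCommGroup F] [NormedSpace ℝ F] (φ : SchwartzMap E F) (K : ℕ) :
    ∃ M > 0, ∀ x, (1 + ‖x‖) ^ K * ‖φ x‖ ≤ M := by
  have hdecay (x : E) :=
    SchwartzMap.one_add_le_sup_seminorm_apply (𝕜 := ℝ) (m := (K, 0)) le_rfl le_rfl φ x
  simp only [norm_iteratedFDeriv_zero] at hdecay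
  exact ⟨_, lt_max_of_lt_right one_pos, fun x => le_max_of_le_left (hdecay x)⟩

/-- On a bounded neighbourhood of the critical frequency `r / (2 t)`, the frequency itself
controls `√(1 + r ^ 2) / t`. -/
lemma sqrt_one_add_sq_div_le {r₀ R r t σ : ℝ} (hr₀ : 0 < r₀) (hR : 0 < R) (ht : 0 < t)
    (hr : r₀ ≤ r) (hσ : |σ - r / (2 * t)| ≤ R) :
    √(1 + r ^ 2) / t ≤ 2 * (1 / r₀ + 1) * (1 + R) * (1 + |σ|) := by
  have hr_pos : 0 < r := hr₀.trans_le hr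
  have hsqrt : √(1 + r ^ 2) ≤ (1 / r₀ + 1) * r := by
    have h1 : 1 ≤ 1 / r₀ * r := by
      rw [one_div_mul_eq_div]; exact (one_le_div hr₀).2 hr
    refine (Real.sqrt_le_left (by positivity)).2 ?_
    nlinarith
  have hcrit : r / (2 * t) ≤ (1 + R) * (1 + |σ|) := by
    nlinarith [(abs_le.1 hσ).1, le_abs_self σ, mul_nonneg hR.le (abs_nonneg σ)]
  calc √(1 + r ^ 2) / t ≤ (1 / r₀ + 1) * r / t := by gcongr
    _ = 2 * (1 / r₀ + 1) * (r / (2 * t)) := by field_simp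
    _ ≤ 2 * (1 / r₀ + 1) * ((1 + R) * (1 + |σ|)) := by gcongr
    _ = _ := by ring

/-- For `ψ ∈ C_c^∞(ℝ)` and `φ` Schwartz, for every `K ∈ ℕ` and `r₀ > 0`
there is `C > 0` such that for all `t ∈ (0,1]` and `r ≥ r₀`:
`|∫_0^∞ e^{i(σ²t - σr)} ψ(σ - r/(2t)) φ(σ) dσ| ≤ C ⟨r⟩^{-K} t^K`, where `⟨r⟩ = √(1+r²)`. -/
theorem stmt12 (ψ : ℝ → ℂ) (hψs : ContDiff ℝ (⊤ : ℕ∞) ψ) (hψc : HasCompactSupport ψ)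
    (φ : SchwartzMap ℝ ℂ) (K : ℕ) (r₀ : ℝ) (hr₀ : 0 < r₀) :
    ∃ C > 0, ∀ t : ℝ, 0 < t → t ≤ 1 → ∀ r : ℝ, r₀ ≤ r →
      ‖∫ σ in Ioi (0 : ℝ),
          Complex.exp (Complex.I * (σ ^ 2 * t - σ * r)) * ψ (σ - r / (2 * t)) * φ σ‖ ≤
        C * t ^ K / Real.sqrt (1 + r ^ 2) ^ K := by
  obtain ⟨M, hM, hφ⟩ := φ.exists_one_add_norm_pow_mul_norm_le K
  obtain ⟨R, hR, hψR⟩ := hψc.isCompact.isBounded.exists_pos_norm_le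
  set B : ℝ := 2 * (1 / r₀ + 1) * (1 + R) with hB
  have hB_pos : 0 < B := by positivity
  have hψ_int : Integrable (fun σ => ‖ψ σ‖) :=
    (hψs.continuous.integrable_of_hasCompactSupport hψc).norm
  have hI : 0 ≤ ∫ σ, ‖ψ σ‖ := integral_nonneg fun _ => norm_nonneg _
  refine ⟨B ^ K * M * ((∫ σ, ‖ψ σ‖) + 1), by positivity, fun t ht _ r hr => ?_⟩
  set D : ℝ := B ^ K * M * (t ^ K / √(1 + r ^ 2) ^ K) with hD
  have hsqrt : 0 < √(1 + r ^ 2) := by positivity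
  have hD_nonneg : 0 ≤ D := by positivity
  have hbound : ∀ σ : ℝ, ‖Complex.exp (Complex.I * (σ ^ 2 * t - σ * r)) *
      ψ (σ - r / (2 * t)) * φ σ‖ ≤ D * ‖ψ (σ - r / (2 * t))‖ := by
    intro σ
    have hexp : ‖Complex.exp (Complex.I * (σ ^ 2 * t - σ * r))‖ = 1 := by
      have := Complex.norm_exp_I_mul_ofReal (σ ^ 2 * t - σ * r)
      push_cast at this
      exact this
    rw [norm_mul, norm_mul, hexp, one_mul, mul_comm]
    by_cases hσ : ψ (σ - r / (2 * t)) = 0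
    · simp [hσ]
    refine mul_le_mul_of_nonneg_right ?_ (norm_nonneg _)
    have hle := sqrt_one_add_sq_div_le hr₀ hR ht hr (hψR _ (subset_tsupport _ hσ))
    have hkey : (√(1 + r ^ 2) / t) ^ K * ‖φ σ‖ ≤ B ^ K * M :=
      calc (√(1 + r ^ 2) / t) ^ K * ‖φ σ‖ ≤ (B * (1 + |σ|)) ^ K * ‖φ σ‖ := by gcongr
        _ = B ^ K * ((1 + ‖σ‖) ^ K * ‖φ σ‖) := by rw [mul_pow, mul_assoc, Real.norm_eq_abs]
        _ ≤ B ^ K * M := by gcongr; exact hφ σ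
    calc ‖φ σ‖ = (√(1 + r ^ 2) / t) ^ K * ‖φ σ‖ * (t ^ K / √(1 + r ^ 2) ^ K) := by
          rw [div_pow]; field_simp
      _ ≤ D := by rw [hD]; gcongr
  have hint : Integrable (fun σ => D * ‖ψ (σ - r / (2 * t))‖) :=
    (hψ_int.comp_sub_right (r / (2 * t))).const_mul D
  calc _ ≤ ∫ σ in Ioi (0 : ℝ), D * ‖ψ (σ - r / (2 * t))‖ :=
        norm_integral_le_of_norm_le hint.integrableOn (Eventually.of_forall hbound)
    _ ≤ ∫ σ, D * ‖ψ (σ - r / (2 * t))‖ :=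
        setIntegral_le_integral hint (Eventually.of_forall fun _ => by positivity)
    _ = D * ∫ σ, ‖ψ σ‖ := by
        rw [integral_const_mul, integral_sub_right_eq_self (fun σ => ‖ψ σ‖)]
    _ ≤ D * ((∫ σ, ‖ψ σ‖) + 1) := by gcongr; linarith
    _ = _ := by rw [hD]; ring
end
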